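/- Let d ≥ 4 and G_n = Z_n^d the discrete torus. For each c > 1, lim_{n→∞} (1/h_d(n)) Σ_{x,y ∈ V_n} (f_{n,c}(x,y) − f̄_{n,c})^2 = α_d, where h_4(n) = n^4 log n and h_d(n) = n^d for d ≥ 5, α_d = (1/G(0;Z^d)^2) Σ_{y ∈ Z^d} G(y;Z^d)^2 for d ≥ 5, and α_4 = lim_{m→∞} (1/(G(0;Z^4)^2 log m)) Σ_{y ∈ Z^4, |y| ≤ m} G(y;Z^4)^2 (which exists and is positive and finite). Here G(x;Z^d) = Σ_{t=0}^∞ p^t(0,x;Z^d) is the Green's function of lazy simple random walk on Z^d. -/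

import Mathlib

open MeasureTheory ProbabilityTheory Filter

attribute [local instance] Classical.propDecidable

noncomputable section

namespace RWPaint

variable {V : Type*} [Fintype V]

/-- The degree of a vertex. -/
def deg (G : SimpleGraph V) (x : V) : ℕ := (Finset.univ.filter fun y => G.Adj x y).card

/-- One-step transition kernel of the lazy random walk on a finite graph:
holding probability `1/2`, otherwise a uniformly chosen neighbour. -/
def K (G : SimpleGraph V) (x y : V) : ℝ :=
  if x = y then (if deg G x = 0 then 1 else 1 / 2)
  else if G.Adj x y then 1 / (2 * (deg G x : ℝ)) else 0

/-- The `t`-step transition kernel. -/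
def Kpow (G : SimpleGraph V) : ℕ → V → V → ℝ
  | 0 => fun x y => if x = y then 1 else 0
  | t + 1 => fun x y => ∑ z, Kpow G t x z * K G z y

/-- The uniform (stationary) probability of a single vertex. -/
def unif (V : Type*) [Fintype V] : ℝ := (Fintype.card V : ℝ)⁻¹

/-- The uniform mixing time. -/
def Tmix (G : SimpleGraph V) : ℕ :=
  sInf {t : ℕ | ∀ x y : V, |Kpow G t x y / unif V - 1| ≤ 1 / 4}

/-- The Green's function `g(x,y) = ∑_{t=0}^{Tmix} p^t(x,y)`. -/
def green (G : SimpleGraph V) (x y : V) : ℝ :=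
  ∑ t ∈ Finset.range (Tmix G + 1), Kpow G t x y

/-- The kernel killed on (entering) the set `S`. -/
def Kkill (G : SimpleGraph V) (S : Finset V) (x y : V) : ℝ :=
  if y ∈ S then 0 else K G x y

/-- Powers of the killed kernel. -/
def KkillPow (G : SimpleGraph V) (S : Finset V) : ℕ → V → V → ℝ
  | 0 => fun x y => if x = y then 1 else 0
  | t + 1 => fun x y => ∑ z, KkillPow G S t x z * Kkill G S z y

/-- `P_x[τ(S) ≤ T]`, the probability that the lazy walk started at `x` visits `S`
by time `T`. -/
def hitBy (G : SimpleGraph V) (S : Finset V) (x : V) (T : ℕ) : ℝ :=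
  if x ∈ S then 1 else 1 - ∑ z, KkillPow G S T x z

/-- `f_{n,c}(x,y) = P_x[τ(y) ≤ c T_mix]`. -/
def fnc (G : SimpleGraph V) (c : ℝ) (x y : V) : ℝ :=
  hitBy G {y} x ⌊c * (Tmix G : ℝ)⌋₊

/-- `f̄_{n,c} = ∑_y f_{n,c}(x,y) π(y)` (averaged also over `x`; by vertex
transitivity this agrees with the value for any fixed `x`). -/
def fbar (G : SimpleGraph V) (c : ℝ) : ℝ :=
  (∑ x : V, ∑ y : V, fnc G c x y) / (Fintype.card V : ℝ) ^ 2

/-- `F_{n,c} = ∑_{x,y} (f_{n,c}(x,y) - f̄_{n,c})^2`. -/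
def Fquad (G : SimpleGraph V) (c : ℝ) : ℝ :=
  ∑ x : V, ∑ y : V, (fnc G c x y - fbar G c) ^ 2

/-- `Γ_n = c₀ T_mix log |V|`. -/
def gammaTime (G : SimpleGraph V) (c₀ : ℝ) : ℕ :=
  ⌊c₀ * (Tmix G : ℝ) * Real.log (Fintype.card V)⌋₊

/-- `P_x[X_t = z | τ(y) ≥ t]` as a combinatorial formula (meaningful for
`x ≠ y` and `t ≥ 1`). -/
def condAtProb (G : SimpleGraph V) (y x z : V) (t : ℕ) : ℝ :=
  (∑ w, KkillPow G {y} (t - 1) x w * K G w z) / (∑ w, KkillPow G {y} (t - 1) x w)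

/-- `∑_{t=0}^{c T_mix} p^t(x,y)`. -/
def greenC (G : SimpleGraph V) (c : ℝ) (x y : V) : ℝ :=
  ∑ t ∈ Finset.range (⌊c * (Tmix G : ℝ)⌋₊ + 1), Kpow G t x y

/-- A graph is vertex transitive if its automorphism group acts transitively. -/
def IsVertexTransitive (G : SimpleGraph V) : Prop :=
  ∀ x y : V, ∃ e : G ≃g G, e x = y

/-- The probability of a trajectory prefix for the lazy walk with initial
distribution `init`. -/
def walkP (G : SimpleGraph V) (init : V → ℝ) (n : ℕ) (v : ℕ → V) : ℝ :=
  init (v 0) * ∏ i ∈ Finset.range n, K G (v i) (v (i + 1))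

/-- Point mass initial distribution. -/
def delta (x : V) : V → ℝ := fun y => if y = x then 1 else 0

/-- Uniform initial distribution. -/
def uinit (V : Type*) [Fintype V] : V → ℝ := fun _ => (Fintype.card V : ℝ)⁻¹

/-- `X₁, X₂` are independent lazy random walks on `G` with initial
distributions `init₁, init₂`, defined on the probability space `(Ω, P)`:
all finite-dimensional distributions factorize as products of trajectory-prefix
probabilities. -/
structure IsWalkPair {Ω : Type*} [MeasurableSpace Ω] (G : SimpleGraph V) (P : Measure Ω)
    (X₁ X₂ : ℕ → Ω → V) (init₁ init₂ : V → ℝ) : Prop where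
  meas₁ : ∀ (t : ℕ) (x : V), MeasurableSet {ω | X₁ t ω = x}
  meas₂ : ∀ (t : ℕ) (x : V), MeasurableSet {ω | X₂ t ω = x}
  law : ∀ (n : ℕ) (v w : ℕ → V),
    (P {ω | (∀ i ≤ n, X₁ i ω = v i) ∧ ∀ i ≤ n, X₂ i ω = w i}).toReal
      = walkP G init₁ n v * walkP G init₂ n w

/-- `X₁, X₂` are independent stationary lazy random walks on `G`, together with
a family `ξ` of independent fair coins (one per vertex, used to break ties),
all defined on the probability space `(Ω, P)`. -/
structure IsPaintSetup {Ω : Type*} [MeasurableSpace Ω] (G : SimpleGraph V) (P : Measure Ω)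
    (X₁ X₂ : ℕ → Ω → V) (ξ : V → Ω → Bool) : Prop where
  meas₁ : ∀ (t : ℕ) (x : V), MeasurableSet {ω | X₁ t ω = x}
  meas₂ : ∀ (t : ℕ) (x : V), MeasurableSet {ω | X₂ t ω = x}
  measξ : ∀ x : V, MeasurableSet {ω | ξ x ω = true}
  law : ∀ (n : ℕ) (v w : ℕ → V) (b : V → Bool),
    (P {ω | ((∀ i ≤ n, X₁ i ω = v i) ∧ ∀ i ≤ n, X₂ i ω = w i) ∧ ∀ x, ξ x ω = b x}).toReal
      = walkP G (uinit V) n v * walkP G (uinit V) n w * (1 / 2) ^ Fintype.card V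

/-- The hitting time `τ(x)` of a vertex `x` (with value `⊤` if `x` is never visited). -/
def hitTime {Ω : Type*} (X : ℕ → Ω → V) (x : V) (ω : Ω) : ℕ∞ :=
  ⨅ (s : ℕ) (_ : X s ω = x), (s : ℕ∞)

/-- `τ(x,y) = τ(x) ⊓ τ(y)`. -/
def hitTime2 {Ω : Type*} (X : ℕ → Ω → V) (x y : V) (ω : Ω) : ℕ∞ :=
  min (hitTime X x ω) (hitTime X y ω)

/-- `|𝒜₁|`: the number of vertices first visited by `X₁` (ties broken by the coins `ξ`). -/
def paintedCount {Ω : Type*} (X₁ X₂ : ℕ → Ω → V) (ξ : V → Ω → Bool) (ω : Ω) : ℕ :=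
  Nat.card {x : V // hitTime X₁ x ω < hitTime X₂ x ω ∨
    (hitTime X₁ x ω = hitTime X₂ x ω ∧ ξ x ω = true)}

/-- The event `H(x,y) = {τ₁(x) < min(τ₁(y), τ₂(x), τ₂(y))}`. -/
def Hevent {Ω : Type*} (X₁ X₂ : ℕ → Ω → V) (x y : V) : Set Ω :=
  {ω | hitTime X₁ x ω < min (hitTime X₁ y ω) (min (hitTime X₂ x ω) (hitTime X₂ y ω))}

/-- `Y₂ = X₂(τ₁(x,y))`. -/
def Ytwo {Ω : Type*} (X₁ X₂ : ℕ → Ω → V) (x y : V) (ω : Ω) : V :=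
  X₂ (hitTime2 X₁ x y ω).toNat ω

/-- `π̃(z;x,y) = P[X₂(τ₁(x,y)) = z | H(x,y)]`. -/
def pitilde {Ω : Type*} [MeasurableSpace Ω] (P : Measure Ω) (X₁ X₂ : ℕ → Ω → V) (x y z : V) : ℝ :=
  (P (Hevent X₁ X₂ x y ∩ {ω | Ytwo X₁ X₂ x y ω = z})).toReal
    / (P (Hevent X₁ X₂ x y)).toReal

/-- The event `A(x,y) = {τ₁(x,y) ≥ τ₂(x,y) > τ₁(x,y) - Γ, τ₁(x) < τ₁(y)}`. -/
def Aevent {Ω : Type*} (X₁ X₂ : ℕ → Ω → V) (x y : V) (Γ : ℕ) : Set Ω :=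
  {ω | hitTime2 X₂ x y ω ≤ hitTime2 X₁ x y ω ∧
    hitTime2 X₁ x y ω - (Γ : ℕ∞) < hitTime2 X₂ x y ω ∧
    hitTime X₁ x ω < hitTime X₁ y ω}

/-- Conditional probability `P[A | B]`. -/
def condGiven {Ω : Type*} [MeasurableSpace Ω] (P : Measure Ω) (A B : Set Ω) : ℝ :=
  (P (A ∩ B)).toReal / (P B).toReal

/-- Assumption 1 of the paper. -/
structure Assumption1 (V : ℕ → Type*) [∀ n, Fintype (V n)]
    (G : ∀ n, SimpleGraph (V n)) : Prop where
  conn : ∀ n, (G n).Connected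
  vt : ∀ n, IsVertexTransitive (G n)
  card_top : Tendsto (fun n => Fintype.card (V n)) atTop atTop
  tmix_small : Tendsto (fun n =>
    (Tmix (G n) : ℝ) * (Real.log (Fintype.card (V n))) ^ 2 / (Fintype.card (V n) : ℝ))
    atTop (nhds 0)
  tmix_top : Tendsto (fun n => Tmix (G n)) atTop atTop
  green_sq_small : ∃ ε : ℕ → ℝ, Tendsto ε atTop (nhds 0) ∧
    ∀ n, ∀ x : V n, ∑ y ∈ Finset.univ.erase x, (green (G n) x y) ^ 2
      ≤ ε n * (Tmix (G n) : ℝ) / Real.log (Fintype.card (V n))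
  hit_miss : ∃ ρ : ℝ, ρ < 1 ∧ ∀ n, ∀ x y z : V n, x ≠ y → x ≠ z → y ≠ z →
    hitBy (G n) {y, z} x (Tmix (G n)) ≤ ρ

/-- The discrete torus `ℤ_n^d`. -/
def torus (d n : ℕ) : SimpleGraph (Fin d → ZMod n) where
  Adj x y := x ≠ y ∧ ∃ i, y - x = Pi.single i 1 ∨ x - y = Pi.single i 1
  symm := by
    refine ⟨?_⟩
    rintro x y ⟨hne, i, h | h⟩
    · exact ⟨hne.symm, i, Or.inr h⟩
    · exact ⟨hne.symm, i, Or.inl h⟩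
  loopless := ⟨fun x h => h.1 rfl⟩

/-- The hypercube `ℤ_2^n`. -/
def hypercube (n : ℕ) : SimpleGraph (Fin n → Bool) where
  Adj x y := x ≠ y ∧ ∃ i, ∀ j, j ≠ i → x j = y j
  symm := by
    refine ⟨?_⟩
    rintro x y ⟨hne, i, h⟩
    exact ⟨hne.symm, i, fun j hj => (h j hj).symm⟩
  loopless := ⟨fun x h => h.1 rfl⟩

/-- The Cayley graph of the symmetric group `S_n` generated by the transpositions. -/
def transpositionGraph (n : ℕ) : SimpleGraph (Equiv.Perm (Fin n)) where
  Adj σ τ := (σ * τ⁻¹).IsSwap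
  symm := by
    refine ⟨?_⟩
    rintro σ τ ⟨a, b, hab, h⟩
    exact ⟨a, b, hab, by rw [show τ * σ⁻¹ = (σ * τ⁻¹)⁻¹ by group, h, Equiv.swap_inv]⟩
  loopless := by
    refine ⟨?_⟩
    intro σ h
    obtain ⟨a, b, hab, h⟩ := h
    rw [mul_inv_cancel] at h
    exact hab (by simpa [Equiv.swap_apply_left] using Equiv.ext_iff.mp h a)

/-- One-step kernel of the lazy simple random walk on `ℤ^d`. -/
def KZ (d : ℕ) (x y : Fin d → ℤ) : ℝ :=
  if x = y then 1 / 2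
  else if ∃ i, y - x = Pi.single i 1 ∨ x - y = Pi.single i 1 then 1 / (4 * d) else 0

/-- `t`-step kernel of the lazy simple random walk on `ℤ^d`. -/
def KZpow (d : ℕ) : ℕ → (Fin d → ℤ) → (Fin d → ℤ) → ℝ
  | 0 => fun x y => if x = y then 1 else 0
  | t + 1 => fun x y => ∑' z, KZpow d t x z * KZ d z y

/-- The Green's function `G(x; ℤ^d) = ∑_{t=0}^∞ p^t(0,x)` of the lazy walk on `ℤ^d`. -/
def greenZ (d : ℕ) (x : Fin d → ℤ) : ℝ := ∑' t : ℕ, KZpow d t 0 x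

/-- `α_d` for `d ≥ 5`. -/
def alphaHigh (d : ℕ) : ℝ := (∑' y : Fin d → ℤ, (greenZ d y) ^ 2) / (greenZ d 0) ^ 2

/-- The normalization `h_d(n)`. -/
def hfun (d n : ℕ) : ℝ :=
  if d = 3 then (n : ℝ) ^ 4
  else if d = 4 then (n : ℝ) ^ 4 * Real.log n
  else (n : ℝ) ^ d

/-- Matrix powers of an abstract kernel. -/
def mpow (p : V → V → ℝ) : ℕ → V → V → ℝ
  | 0 => fun x y => if x = y then 1 else 0
  | t + 1 => fun x y => ∑ z, mpow p t x z * p z y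

/-- Total variation distance between two (probability) vectors. -/
def tvDist (μ ν : V → ℝ) : ℝ := (1 / 2) * ∑ x, |μ x - ν x|


section walk
variable {A : Type*} [AddCommGroup A] {d : ℕ}

/-- the Markov operator of the lazy walk -/
def Mop (e : Fin d → A) : Module.End ℝ (A → ℝ) where
  toFun h := fun x => h x / 2 + (1 / (4 * (d : ℝ))) * ∑ i, (h (x + e i) + h (x - e i))
  map_add' f g := by
    funext x
    simp only [Pi.add_apply, Finset.sum_add_distrib]
    ring
  map_smul' c f := by
    funext x
    simp only [Pi.smul_apply, smul_eq_mul, RingHom.id_apply, ← mul_add, ← Finset.mul_sum]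
    ring

lemma Mop_apply (e : Fin d → A) (h : A → ℝ) (x : A) :
    Mop e h x = h x / 2 + (1 / (4 * (d : ℝ))) * ∑ i, (h (x + e i) + h (x - e i)) := rfl

/-- heat kernel -/
def Pw (e : Fin d → A) (t : ℕ) : A → ℝ := (Mop e ^ t) (fun x => if x = 0 then 1 else 0)

lemma Mop_pow_succ (e : Fin d → A) (t : ℕ) (h : A → ℝ) :
    (Mop e ^ (t + 1)) h = Mop e ((Mop e ^ t) h) := by
  rw [pow_succ']; rfl

lemma Mop_pow_succ' (e : Fin d → A) (t : ℕ) (h : A → ℝ) :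
    (Mop e ^ (t + 1)) h = (Mop e ^ t) (Mop e h) := by
  rw [pow_succ]; rfl

lemma Pw_zero (e : Fin d → A) (y : A) : Pw e 0 y = if y = 0 then 1 else 0 := by
  simp [Pw]

lemma Pw_succ (e : Fin d → A) (t : ℕ) : Pw e (t + 1) = Mop e (Pw e t) := by
  rw [Pw, Mop_pow_succ, ← Pw]

lemma Mop_mono (e : Fin d → A) {f g : A → ℝ} (h : ∀ x, f x ≤ g x) (x : A) :
    Mop e f x ≤ Mop e g x := by
  rw [Mop_apply, Mop_apply]
  have := h x
  have h2 : ∑ i, (f (x + e i) + f (x - e i)) ≤ ∑ i, (g (x + e i) + g (x - e i)) :=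
    Finset.sum_le_sum fun i _ => add_le_add (h _) (h _)
  gcongr

lemma Mop_pow_mono (e : Fin d → A) (t : ℕ) {f g : A → ℝ} (h : ∀ x, f x ≤ g x) (x : A) :
    (Mop e ^ t) f x ≤ (Mop e ^ t) g x := by
  induction t generalizing x with
  | zero => simpa using h x
  | succ t ih => rw [Mop_pow_succ, Mop_pow_succ]; exact Mop_mono e ih x

lemma Mop_const (hd : 0 < d) (e : Fin d → A) (c : ℝ) : Mop e (fun _ => c) = fun _ => c := by
  funext x
  rw [Mop_apply]
  have : (d : ℝ) ≠ 0 := by positivity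
  simp
  field_simp
  ring

lemma Mop_pow_const (hd : 0 < d) (e : Fin d → A) (t : ℕ) (c : ℝ) :
    (Mop e ^ t) (fun _ => c) = fun _ => c := by
  induction t with
  | zero => simp
  | succ t ih => rw [Mop_pow_succ, ih, Mop_const hd]

lemma Mop_pow_nonneg (e : Fin d → A) (t : ℕ) {f : A → ℝ} (h : ∀ x, 0 ≤ f x) (x : A) :
    0 ≤ (Mop e ^ t) f x := by
  have := Mop_pow_mono e t (f := 0) (g := f) h x
  simpa using this

lemma Pw_nonneg (e : Fin d → A) (t : ℕ) (y : A) : 0 ≤ Pw e t y :=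
  Mop_pow_nonneg e t (fun x => by split_ifs <;> norm_num) y

lemma Pw_le_one (hd : 0 < d) (e : Fin d → A) (t : ℕ) (y : A) : Pw e t y ≤ 1 := by
  have := Mop_pow_mono e t (f := fun x : A => if x = 0 then (1:ℝ) else 0) (g := fun _ => 1)
    (fun x => by split_ifs <;> norm_num) y
  rwa [Mop_pow_const hd] at this

lemma hasSum_Pw (e : Fin d → A) (t : ℕ) (h : A → ℝ) :
    HasSum (fun y => Pw e t y * h y) ((Mop e ^ t) h 0) := by
  induction t generalizing h with
  | zero =>
    have : (fun y => Pw e 0 y * h y) = fun y => if y = 0 then h 0 else 0 := by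
      funext y
      rw [Pw_zero]
      split_ifs with hy
      · simp [hy]
      · simp
    rw [this]
    simpa using hasSum_ite_eq (0 : A) (h 0)
  | succ t ih =>
    have h1 : ∀ i, HasSum (fun y => Pw e t (y + e i) * h y) ((Mop e ^ t) (fun y => h (y - e i)) 0) := by
      intro i
      have := (Equiv.addRight (e i)).hasSum_iff.mpr (ih (fun y => h (y - e i)))
      convert this using 2 with y
      simp
    have h2 : ∀ i, HasSum (fun y => Pw e t (y - e i) * h y) ((Mop e ^ t) (fun y => h (y + e i)) 0) := by
      intro i
      have := (Equiv.subRight (e i)).hasSum_iff.mpr (ih (fun y => h (y + e i)))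
      convert this using 2 with y
      simp
    have h3 := ((ih h).div_const 2).add
      ((hasSum_sum (s := Finset.univ) fun i _ => (h1 i).add (h2 i)).mul_left (1 / (4 * (d : ℝ))))
    have e1 : (fun y => Pw e (t + 1) y * h y) = fun y => Pw e t y * h y / 2 +
        1 / (4 * (d : ℝ)) * ∑ i, (Pw e t (y + e i) * h y + Pw e t (y - e i) * h y) := by
      funext y
      rw [Pw_succ, Mop_apply, add_mul, mul_assoc, Finset.sum_mul]
      congr 1
      · ring
      · congr 1
        exact Finset.sum_congr rfl fun i _ => by ring
    have e2 : (Mop e ^ (t + 1)) h 0 = (Mop e ^ t) h 0 / 2 + 1 / (4 * (d : ℝ)) *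
        ∑ i, ((Mop e ^ t) (fun y => h (y - e i)) 0 + (Mop e ^ t) (fun y => h (y + e i)) 0) := by
      rw [Mop_pow_succ']
      have : Mop e h = (1 / 2 : ℝ) • h + (1 / (4 * (d : ℝ))) •
          ∑ i, ((fun y => h (y - e i)) + (fun y => h (y + e i))) := by
        funext x
        simp only [Mop_apply, Pi.add_apply, Pi.smul_apply, smul_eq_mul, Finset.sum_apply]
        congr 1
        · ring
        · congr 1
          exact Finset.sum_congr rfl fun i _ => by ring
      rw [this]
      simp only [map_add, map_smul, map_sum, Pi.add_apply, Pi.smul_apply, smul_eq_mul,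
        Finset.sum_apply]
      ring
    rw [e1, e2]
    exact h3

lemma Pw_add (e : Fin d → A) (s t : ℕ) : HasSum (fun y => Pw e s y * Pw e t y) (Pw e (s + t) 0) := by
  have := hasSum_Pw e s (Pw e t)
  have h2 : (Mop e ^ s) (Pw e t) = Pw e (s + t) := by
    rw [Pw, Pw, pow_add]; rfl
  rwa [h2] at this

lemma Pw_sum_one (hd : 0 < d) (e : Fin d → A) (t : ℕ) : HasSum (fun y => Pw e t y) 1 := by
  have := hasSum_Pw e t (fun _ => 1)
  rw [Mop_pow_const hd] at this
  simpa using this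

lemma Mop_pow_trans (e : Fin d → A) (t : ℕ) (h : A → ℝ) (a x : A) :
    (Mop e ^ t) (fun x => h (a + x)) x = (Mop e ^ t) h (a + x) := by
  induction t generalizing x with
  | zero => simp
  | succ t ih =>
    rw [Mop_pow_succ, Mop_pow_succ, Mop_apply, Mop_apply]
    simp only [ih, add_assoc, add_sub_assoc]

lemma Mop_pow_comp {B : Type*} [AddCommGroup B] (e : Fin d → A) (e' : Fin d → B) (f : A →+ B)
    (hf : ∀ i, f (e i) = e' i) (t : ℕ) (h : B → ℝ) (x : A) :
    (Mop e ^ t) (fun x => h (f x)) x = (Mop e' ^ t) h (f x) := by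
  induction t generalizing x with
  | zero => simp
  | succ t ih =>
    rw [Mop_pow_succ, Mop_pow_succ, Mop_apply, Mop_apply]
    simp only [ih, map_add, map_sub, hf]

lemma Mop_pow_neg (e : Fin d → A) (t : ℕ) (h : A → ℝ) (x : A) :
    (Mop e ^ t) (fun x => h (-x)) x = (Mop e ^ t) h (-x) := by
  induction t generalizing x with
  | zero => simp
  | succ t ih =>
    rw [Mop_pow_succ, Mop_pow_succ, Mop_apply, Mop_apply]
    simp only [ih]
    congr 2
    refine Finset.sum_congr rfl fun i _ => ?_
    rw [add_comm, neg_add, neg_sub, sub_eq_add_neg, sub_eq_add_neg, add_comm (e i)]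

lemma Pw_neg (e : Fin d → A) (t : ℕ) (x : A) : Pw e t (-x) = Pw e t x := by
  rw [Pw, ← Mop_pow_neg]
  simp

/-- Chapman-Kolmogorov for expectation functionals, with Fubini. -/
lemma Mop_fubini (e : Fin d → A) (s t : ℕ) (H : A → A → ℝ) :
    (Mop e ^ s) (fun y => (Mop e ^ t) (fun z => H y z) 0) 0 =
    (Mop e ^ t) (fun z => (Mop e ^ s) (fun y => H y z) 0) 0 := by
  induction s generalizing H with
  | zero => simp
  | succ s ih =>
    simp only [Mop_pow_succ']
    rw [← ih (fun y z => Mop e (fun y => H y z) y)]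
    refine congrFun (congrArg (Mop e ^ s) ?_) 0
    funext y
    rw [Mop_apply]
    have : (fun z => Mop e (fun y => H y z) y) = (1 / 2 : ℝ) • (fun z => H y z) +
        (1 / (4 * (d : ℝ))) • ∑ i, ((fun z => H (y + e i) z) + (fun z => H (y - e i) z)) := by
      funext z
      simp only [Mop_apply, Pi.add_apply, Pi.smul_apply, smul_eq_mul, Finset.sum_apply]
      ring
    rw [this]
    simp only [map_add, map_smul, map_sum, Pi.add_apply, Pi.smul_apply, smul_eq_mul,
        Finset.sum_apply]
    ring

lemma Mop_pow_add_apply (e : Fin d → A) (s t : ℕ) (h : A → ℝ) :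
    (Mop e ^ (s + t)) h 0 = (Mop e ^ s) (fun y => (Mop e ^ t) (fun z => h (y + z)) 0) 0 := by
  rw [pow_add, Module.End.mul_apply]
  refine congrFun (congrArg (Mop e ^ s) ?_) 0
  funext y
  rw [Mop_pow_trans, add_zero]

end walk


section hitting

lemma K_nonneg (G : SimpleGraph V) (x y : V) : 0 ≤ K G x y := by
  unfold K
  split_ifs <;> positivity

lemma Kpow_back (G : SimpleGraph V) (t : ℕ) (x y : V) :
    Kpow G (t + 1) x y = ∑ z, K G x z * Kpow G t z y := by
  induction t generalizing y with
  | zero => simp [Kpow]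
  | succ t ih =>
    rw [Kpow]
    simp only [ih]
    simp only [Kpow, Finset.sum_mul, Finset.mul_sum]
    rw [Finset.sum_comm]
    simp only [mul_assoc]

lemma Kpow_nonneg (G : SimpleGraph V) (t : ℕ) (x y : V) : 0 ≤ Kpow G t x y := by
  induction t generalizing y with
  | zero => simp only [Kpow]; split_ifs <;> norm_num
  | succ t ih => exact Finset.sum_nonneg fun z _ => mul_nonneg (ih z) (K_nonneg G z y)

lemma KkillPow_back (G : SimpleGraph V) (S : Finset V) (t : ℕ) (x y : V) :
    KkillPow G S (t + 1) x y = ∑ z, Kkill G S x z * KkillPow G S t z y := by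
  induction t generalizing y with
  | zero => simp [KkillPow]
  | succ t ih =>
    rw [KkillPow]
    simp only [ih]
    simp only [KkillPow, Finset.sum_mul, Finset.mul_sum]
    rw [Finset.sum_comm]
    simp only [mul_assoc]

lemma hitBy_self (G : SimpleGraph V) (y : V) (T : ℕ) : hitBy G {y} y T = 1 := by
  simp [hitBy]

lemma hitBy_zero (G : SimpleGraph V) (y x : V) : hitBy G {y} x 0 = if x = y then 1 else 0 := by
  by_cases h : x = y <;> simp [hitBy, KkillPow, h]

lemma hitBy_succ (G : SimpleGraph V) (hK : ∀ x, ∑ z, K G x z = 1) {y x : V} (hxy : x ≠ y) (T : ℕ) :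
    hitBy G {y} x (T + 1) = ∑ z, K G x z * hitBy G {y} z T := by
  have h1 : hitBy G {y} x (T + 1) = 1 - ∑ z, Kkill G {y} x z * ∑ w, KkillPow G {y} T z w := by
    simp only [hitBy, Finset.mem_singleton, hxy, if_false, KkillPow_back]
    rw [Finset.sum_comm]
    simp only [Finset.mul_sum]
  rw [h1, ← hK x, ← Finset.sum_sub_distrib]
  refine Finset.sum_congr rfl fun z _ => ?_
  by_cases hz : z = y
  · simp [Kkill, hitBy, hz]
  · simp [Kkill, hitBy, hz, mul_sub]

/-- truncated green function -/
def gT (G : SimpleGraph V) (T : ℕ) (x y : V) : ℝ := ∑ s ∈ Finset.range (T + 1), Kpow G s x y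

lemma gT_zero (G : SimpleGraph V) (x y : V) : gT G 0 x y = if x = y then 1 else 0 := by
  simp [gT, Kpow]

lemma gT_succ (G : SimpleGraph V) (T : ℕ) (x y : V) :
    gT G (T + 1) x y = (if x = y then 1 else 0) + ∑ z, K G x z * gT G T z y := by
  rw [gT, Finset.sum_range_succ']
  simp only [Kpow_back, gT, Finset.mul_sum]
  rw [Finset.sum_comm, add_comm]
  rfl

lemma gT_nonneg (G : SimpleGraph V) (T : ℕ) (x y : V) : 0 ≤ gT G T x y :=
  Finset.sum_nonneg fun _ _ => Kpow_nonneg _ _ _ _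

lemma gT_mono (G : SimpleGraph V) {S T : ℕ} (h : S ≤ T) (x y : V) : gT G S x y ≤ gT G T x y :=
  Finset.sum_le_sum_of_subset_of_nonneg (Finset.range_mono (by omega))
    fun _ _ _ => Kpow_nonneg _ _ _ _

lemma hit_lower (G : SimpleGraph V) (hK : ∀ x, ∑ z, K G x z = 1) (x y : V) (T : ℕ) :
    gT G T x y ≤ gT G T y y * hitBy G {y} x T := by
  induction T generalizing x with
  | zero => simp [gT_zero, hitBy_zero]
  | succ T ih =>
    by_cases h : x = y
    · subst h; simp [hitBy_self]
    · rw [gT_succ, if_neg h, zero_add, hitBy_succ G hK h, Finset.mul_sum]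
      refine Finset.sum_le_sum fun z _ => ?_
      have h1 := ih z
      have h0 : 0 ≤ hitBy G {y} z T := by
        by_contra hneg
        push Not at hneg
        have hpos : 0 < gT G T y y := by
          have := gT_mono G (Nat.zero_le T) y y
          rw [gT_zero, if_pos rfl] at this
          linarith
        have := gT_nonneg G T z y
        nlinarith
      have h2 := gT_mono G (Nat.le_succ T) y y
      have h3 := K_nonneg G x z
      have h4 : gT G T z y ≤ gT G (T+1) y y * hitBy G {y} z T := by nlinarith
      calc K G x z * gT G T z y ≤ K G x z * (gT G (T+1) y y * hitBy G {y} z T) := by gcongr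
        _ = _ := by ring

lemma hit_upper (G : SimpleGraph V) (hK : ∀ x, ∑ z, K G x z = 1) (x y : V) (T S : ℕ) :
    gT G T y y * hitBy G {y} x S ≤ gT G (T + S) x y := by
  induction S generalizing x with
  | zero =>
    by_cases h : x = y
    · simp [hitBy_zero, h]
    · simp [hitBy_zero, h, gT_nonneg]
  | succ S ih =>
    by_cases h : x = y
    · subst h; simp only [hitBy_self, mul_one]
      exact gT_mono _ (by omega) _ _
    · rw [← add_assoc, gT_succ, if_neg h, zero_add, hitBy_succ G hK h, Finset.mul_sum]
      refine Finset.sum_le_sum fun z _ => ?_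
      have h3 := K_nonneg G x z
      calc gT G T y y * (K G x z * hitBy G {y} z S)
          = K G x z * (gT G T y y * hitBy G {y} z S) := by ring
        _ ≤ _ := by gcongr; exact ih z

end hitting

section nbrs
variable {A : Type*} [AddCommGroup A] {d : ℕ}

/-- the signed generators -/
def sgn (e : Fin d → A) (p : Fin d × Bool) : A := if p.2 then e p.1 else - e p.1

lemma sum_sgn (e : Fin d → A) (h : A → ℝ) (x : A) :
    ∑ p, h (x + sgn e p) = ∑ i, (h (x + e i) + h (x - e i)) := by
  rw [Fintype.sum_prod_type]
  simp [sgn, sub_eq_add_neg]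

/-- neighbours -/
def nbr (e : Fin d → A) (x : A) : Finset A := Finset.univ.image fun p => x + sgn e p

lemma mem_nbr (e : Fin d → A) (x z : A) :
    z ∈ nbr e x ↔ ∃ i, z - x = e i ∨ x - z = e i := by
  simp only [nbr, Finset.mem_image, Finset.mem_univ, true_and, Prod.exists, Bool.exists_bool, sgn]
  constructor
  · rintro ⟨i, h | h⟩
    · exact ⟨i, Or.inr (by rw [← h]; simp)⟩
    · exact ⟨i, Or.inl (by rw [← h]; simp)⟩
  · rintro ⟨i, h | h⟩
    · exact ⟨i, Or.inr (by rw [← h]; simp)⟩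
    · exact ⟨i, Or.inl (by rw [← h]; simp)⟩

lemma sum_nbr (e : Fin d → A) (he : Function.Injective (sgn e)) (h : A → ℝ) (x : A) :
    ∑ z ∈ nbr e x, h z = ∑ i, (h (x + e i) + h (x - e i)) := by
  rw [nbr, Finset.sum_image, sum_sgn]
  intro p _ q _ hpq
  exact he (add_left_cancel hpq)

lemma sgn_single_injective {R : Type*} [Ring R] (h1 : (1 : R) ≠ 0) (h2 : (1 : R) ≠ -1) :
    Function.Injective (sgn (fun i : Fin d => (Pi.single i 1 : Fin d → R))) := by
  rintro ⟨i, b⟩ ⟨j, c⟩ h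
  have h3 := congrFun h i
  have hij : i = j := by
    by_contra hij
    cases b <;> cases c <;> simp [sgn, Pi.single_apply, hij, h1] at h3
  subst hij
  cases b <;> cases c <;> simp [sgn] at h3 ⊢
  · exact h2 h3.symm
  · exact h2 h3

lemma sgn_single_ne {R : Type*} [Ring R] (h1 : (1 : R) ≠ 0) (p : Fin d × Bool) :
    sgn (fun i : Fin d => (Pi.single i 1 : Fin d → R)) p ≠ 0 := by
  intro h
  have h3 := congrFun h p.1
  obtain ⟨i, b⟩ := p
  cases b <;> simp [sgn, h1] at h3

end nbrs

section torusK
variable {d N : ℕ} [NeZero N]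

/-- torus generators -/
def eT (d N : ℕ) : Fin d → (Fin d → ZMod N) := fun i => Pi.single i 1

/-- lattice generators -/
def eZ (d : ℕ) : Fin d → (Fin d → ℤ) := fun i => Pi.single i 1

lemma zmod_one_ne (hN : 3 ≤ N) : (1 : ZMod N) ≠ 0 ∧ (1 : ZMod N) ≠ -1 := by
  have : Fact (1 < N) := ⟨by omega⟩
  refine ⟨one_ne_zero, fun h => ?_⟩
  have h2 : ((2 : ℕ) : ZMod N) = 0 := by
    push_cast
    have : (1 : ZMod N) + 1 = 0 := by nth_rewrite 2 [h]; simp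
    rw [← this]; norm_num
  rw [ZMod.natCast_eq_zero_iff] at h2
  exact absurd (Nat.le_of_dvd (by norm_num) h2) (by omega)

lemma torus_adj (hN : 3 ≤ N) (x z : Fin d → ZMod N) :
    (torus d N).Adj x z ↔ z ∈ nbr (eT d N) x := by
  rw [mem_nbr]
  constructor
  · exact fun h => h.2
  · intro h
    refine ⟨?_, h⟩
    rintro rfl
    have := (mem_nbr (eT d N) x x).2 h
    simp only [nbr, Finset.mem_image] at this
    obtain ⟨p, _, hp⟩ := this
    exact sgn_single_ne (zmod_one_ne hN).1 p (add_eq_left.mp hp)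

lemma torus_K (hd : 0 < d) (hN : 3 ≤ N) (h : (Fin d → ZMod N) → ℝ) (x : Fin d → ZMod N) :
    ∑ z, K (torus d N) x z * h z = Mop (eT d N) h x := by
  have hinj := sgn_single_injective (d := d) (zmod_one_ne hN).1 (zmod_one_ne hN).2
  have hf : (Finset.univ.filter fun y => (torus d N).Adj x y) = nbr (eT d N) x := by
    ext z; simp [torus_adj hN]
  have hdeg : (deg (torus d N) x : ℝ) = 2 * d := by
    rw [deg, hf]
    have := sum_nbr (eT d N) hinj (fun _ => 1) x
    simp at this
    rw [this]; ring
  have hdeg' : deg (torus d N) x ≠ 0 := by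
    intro h0
    rw [h0] at hdeg
    have : (0:ℝ) < d := by exact_mod_cast hd
    simp at hdeg
    omega
  have : ∀ z, K (torus d N) x z * h z = (if x = z then h x / 2 else 0) +
      (if z ∈ nbr (eT d N) x then 1 / (4 * (d:ℝ)) * h z else 0) := by
    intro z
    by_cases hxz : x = z
    · subst hxz
      have : ¬ (x ∈ nbr (eT d N) x) := by rw [← torus_adj hN]; exact SimpleGraph.irrefl _
      simp only [K, hdeg', this]
      simp
      ring
    · simp only [K, hxz, torus_adj hN, hdeg, if_false, zero_add]
      split_ifs
      · ring
      · ring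
  simp only [this, Finset.sum_add_distrib]
  rw [Mop_apply, ← sum_nbr (eT d N) hinj, Finset.mul_sum]
  simp

lemma torus_K_sum (hd : 0 < d) (hN : 3 ≤ N) (x : Fin d → ZMod N) :
    ∑ z, K (torus d N) x z = 1 := by
  have := torus_K hd hN (fun _ => 1) x
  rw [Mop_const hd] at this
  simpa using this

lemma torus_Kpow (hd : 0 < d) (hN : 3 ≤ N) (t : ℕ) (x y : Fin d → ZMod N) :
    Kpow (torus d N) t x y = Pw (eT d N) t (y - x) := by
  induction t generalizing x with
  | zero => simp [Kpow, Pw_zero, sub_eq_zero, eq_comm]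
  | succ t ih =>
    rw [Kpow_back]
    simp only [ih]
    rw [torus_K hd hN (fun z => Pw (eT d N) t (y - z)), Pw_succ, Mop_apply, Mop_apply]
    congr 2
    refine Finset.sum_congr rfl fun i _ => ?_
    rw [add_comm]
    congr 2 <;> abel

lemma KZ_eq (h : (Fin d → ℤ) → ℝ) (y : Fin d → ℤ) :
    ∑' z, h z * KZ d z y = Mop (eZ d) h y := by
  have hinj := sgn_single_injective (d := d) (R := ℤ) (by norm_num) (by norm_num)
  have : ∀ z, h z * KZ d z y = (if z = y then h y / 2 else 0) +
      (if z ∈ nbr (eZ d) y then 1 / (4 * (d:ℝ)) * h z else 0) := by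
    intro z
    have hm : z ∈ nbr (eZ d) y ↔ ∃ i, y - z = Pi.single i 1 ∨ z - y = Pi.single i 1 := by
      rw [mem_nbr]
      exact exists_congr fun i => or_comm
    by_cases hxz : z = y
    · subst hxz
      have : ¬ (z ∈ nbr (eZ d) z) := by
        simp only [nbr, Finset.mem_image]
        rintro ⟨p, _, hp⟩
        exact sgn_single_ne (R := ℤ) (by norm_num) p (add_eq_left.mp hp)
      simp only [KZ, this]
      simp
      ring
    · simp only [KZ, hxz, ← hm, if_false, zero_add]
      split_ifs
      · ring
      · ring
  simp only [this]
  rw [Mop_apply, ← sum_nbr (eZ d) hinj, Finset.mul_sum]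
  have h1 : HasSum (fun z => if z = y then h y / 2 else 0) (h y / 2) := hasSum_ite_eq y _
  have h2 : HasSum (fun z => if z ∈ nbr (eZ d) y then 1 / (4 * (d:ℝ)) * h z else 0)
      (∑ z ∈ nbr (eZ d) y, 1 / (4 * (d:ℝ)) * h z) := by
    have := hasSum_sum_of_ne_finset_zero (L := .unconditional _) (s := nbr (eZ d) y)
      (f := fun z => if z ∈ nbr (eZ d) y then 1 / (4 * (d:ℝ)) * h z else 0)
      (fun b hb => by simp [hb])
    rwa [Finset.sum_congr rfl (fun z hz => if_pos hz)] at this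
  exact (h1.add h2).tsum_eq

lemma KZpow_eq (t : ℕ) (y : Fin d → ℤ) : KZpow d t 0 y = Pw (eZ d) t y := by
  induction t generalizing y with
  | zero => simp [KZpow, Pw_zero, eq_comm]
  | succ t ih =>
    rw [KZpow]
    simp only [ih]
    rw [KZ_eq, Pw_succ]

end torusK


section fourier
variable {d N : ℕ} [NeZero N]

/-- symbol of the torus walk -/
def phiT (k : Fin d → ZMod N) : ℝ := 1 / 2 + (1 / (2 * (d : ℝ))) * ∑ i, (ZMod.stdAddChar (k i)).re

/-- real characters -/
def cT (k y : Fin d → ZMod N) : ℝ := (ZMod.stdAddChar (k ⬝ᵥ y)).re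

lemma Mop_cT (k : Fin d → ZMod N) : Mop (eT d N) (cT k) = phiT k • cT k := by
  funext y
  rw [Mop_apply]
  have : ∀ i, cT k (y + eT d N i) + cT k (y - eT d N i)
      = 2 * (ZMod.stdAddChar (k i)).re * cT k y := by
    intro i
    have hc : (ZMod.stdAddChar (-(k i)) : ℂ) = (starRingEnd ℂ) (ZMod.stdAddChar (k i)) :=
      AddChar.map_neg_eq_conj _ _
    simp only [cT, eT, dotProduct_add, dotProduct_single, mul_one, sub_eq_add_neg,
      dotProduct_neg, AddChar.map_add_eq_mul, hc]
    simp
    ring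
  simp only [this, ← Finset.sum_mul, ← Finset.mul_sum]
  simp only [phiT, Pi.smul_apply, smul_eq_mul]
  ring

lemma Mop_pow_cT (k : Fin d → ZMod N) (t : ℕ) :
    (Mop (eT d N) ^ t) (cT k) = phiT k ^ t • cT k := by
  induction t with
  | zero => simp
  | succ t ih => rw [Mop_pow_succ, ih, map_smul, Mop_cT, smul_smul, pow_succ]

lemma Pw_eq {A : Type*} [AddCommGroup A] (e : Fin d → A) (t : ℕ) :
    Pw e t = (Mop e ^ t) (Pw e 0) := by
  simp [Pw]

lemma sum_cT (y : Fin d → ZMod N) : ∑ k, cT k y = if y = 0 then (N : ℝ) ^ d else 0 := by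
  have h1 : ∀ k : Fin d → ZMod N, (ZMod.stdAddChar (k ⬝ᵥ y) : ℂ)
      = ∏ i, ZMod.stdAddChar (k i * y i) := by
    intro k
    rw [dotProduct]
    generalize (Finset.univ : Finset (Fin d)) = s
    induction s using Finset.induction_on with
    | empty => simp
    | insert a s ha ih => rw [Finset.sum_insert ha, Finset.prod_insert ha, AddChar.map_add_eq_mul, ih]
  have h2 : ∑ k : Fin d → ZMod N, (ZMod.stdAddChar (k ⬝ᵥ y) : ℂ)
      = ∏ i, ∑ j : ZMod N, ZMod.stdAddChar (j * y i) := by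
    simp only [h1]
    rw [Finset.prod_univ_sum]
    simp
  simp only [cT]
  rw [← Complex.re_sum, h2]
  simp only [AddChar.sum_mulShift _ (ZMod.isPrimitive_stdAddChar N), ZMod.card]
  split_ifs with hy
  · subst hy
    simp
    norm_cast
  · obtain ⟨i, hi⟩ := Function.ne_iff.mp hy
    rw [Finset.prod_eq_zero (Finset.mem_univ i)]
    · simp
    · simp at hi
      simp [hi]

lemma Pw_fourier (t : ℕ) (y : Fin d → ZMod N) :
    Pw (eT d N) t y = ((N : ℝ) ^ d)⁻¹ * ∑ k, phiT k ^ t * cT k y := by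
  have hN : (N : ℝ) ^ d ≠ 0 := by
    have := NeZero.ne N
    positivity
  have : Pw (eT d N) 0 = ((N : ℝ) ^ d)⁻¹ • ∑ k, cT k := by
    funext x
    rw [Pw_zero]
    simp only [Pi.smul_apply, Finset.sum_apply, sum_cT, smul_eq_mul]
    split_ifs
    · field_simp
    · simp
  rw [Pw_eq, this]
  simp only [map_smul, map_sum, Mop_pow_cT, Pi.smul_apply, Finset.sum_apply, smul_eq_mul]

lemma std_re (j : ZMod N) : (ZMod.stdAddChar j : ℂ).re = Real.cos (2 * Real.pi * j.val / N) := by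
  rw [ZMod.stdAddChar_apply, ZMod.toCircle_apply]
  have : (2 * (Real.pi : ℂ) * Complex.I * (j.val : ℂ) / (N : ℂ))
      = ((2 * Real.pi * j.val / N : ℝ) : ℂ) * Complex.I := by
    push_cast; ring
  rw [this, Complex.exp_ofReal_mul_I_re]

lemma phiT_eq (hd : 0 < d) (k : Fin d → ZMod N) :
    phiT k = 1 - ∑ i, (1 / (2 * (d : ℝ))) * (1 - Real.cos (2 * Real.pi * (k i).val / N)) := by
  have : (d : ℝ) ≠ 0 := by positivity
  rw [phiT, ← Finset.mul_sum, Finset.sum_sub_distrib]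
  simp only [std_re]
  simp
  field_simp
  ring

lemma phiT_nonneg (hd : 0 < d) (k : Fin d → ZMod N) : 0 ≤ phiT k := by
  have : (0:ℝ) < d := by positivity
  rw [phiT]
  have h : -(d:ℝ) ≤ ∑ i, (ZMod.stdAddChar (k i) : ℂ).re := by
    have := Finset.sum_le_sum (s := Finset.univ) (f := fun _ : Fin d => (-1 : ℝ))
      (g := fun i => (ZMod.stdAddChar (k i) : ℂ).re)
      (fun i _ => by rw [std_re]; exact Real.neg_one_le_cos _)
    simpa using this
  have h2 : (1 / (2 * (d : ℝ))) * (-(d:ℝ)) ≤ (1 / (2 * (d : ℝ))) * ∑ i, (ZMod.stdAddChar (k i) : ℂ).re := by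
    gcongr
  have h3 : (1 / (2 * (d : ℝ))) * (-(d:ℝ)) = -(1/2) := by field_simp
  linarith

lemma phiT_pow_le (hd : 0 < d) (k : Fin d → ZMod N) (t : ℕ) :
    phiT k ^ t ≤ ∏ i, Real.exp (-(t / (2 * (d : ℝ))) * (1 - Real.cos (2 * Real.pi * (k i).val / N))) := by
  rw [← Real.exp_sum]
  have h1 : phiT k ≤ Real.exp (-∑ i, (1 / (2 * (d : ℝ))) * (1 - Real.cos (2 * Real.pi * (k i).val / N))) := by
    rw [phiT_eq hd]
    have := Real.add_one_le_exp (-∑ i, (1 / (2 * (d : ℝ))) * (1 - Real.cos (2 * Real.pi * (k i).val / N)))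
    linarith
  calc phiT k ^ t ≤ _ := pow_le_pow_left₀ (phiT_nonneg hd k) h1 t
    _ = _ := by
      rw [← Real.exp_nat_mul]
      congr 1
      rw [← Finset.mul_sum, ← Finset.mul_sum]
      ring

lemma gauss_sum (a : ℝ) (ha : 0 < a) (m : ℕ) :
    ∑ i ∈ Finset.range m, Real.exp (-a * ((i + 1 : ℕ) : ℝ) ^ 2) ≤ √(Real.pi / a) / 2 := by
  have hanti : AntitoneOn (fun x : ℝ => Real.exp (-a * x ^ 2)) (Set.Icc 0 (0 + (m : ℝ))) := by
    intro x hx y hy hxy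
    have : x ^ 2 ≤ y ^ 2 := pow_le_pow_left₀ hx.1 hxy 2
    simp only [Real.exp_le_exp]
    nlinarith
  have h1 := hanti.sum_le_integral
  simp only [zero_add] at h1
  refine h1.trans ?_
  rw [← integral_gaussian_Ioi, intervalIntegral.integral_of_le (by positivity)]
  refine setIntegral_mono_set ?_ ?_ ?_
  · exact (integrable_exp_neg_mul_sq ha).integrableOn
  · exact Eventually.of_forall fun x => (Real.exp_pos _).le
  · exact (Set.Ioc_subset_Ioi_self).eventuallyLE

lemma theta_bound (hd : 0 < d) (t : ℕ) (ht : 0 < t) :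
    ∑ j : ZMod N, Real.exp (-(t / (2 * (d : ℝ))) * (1 - Real.cos (2 * Real.pi * j.val / N)))
      ≤ 1 + N * √(Real.pi * d / (4 * t)) := by
  set F : ℕ → ℝ := fun v => Real.exp (-(t / (2 * (d : ℝ))) * (1 - Real.cos (2 * Real.pi * v / N)))
  have hNp : 0 < N := Nat.pos_of_ne_zero (NeZero.ne N)
  have hN : (0:ℝ) < N := by exact_mod_cast hNp
  have hdp : (0:ℝ) < d := by exact_mod_cast hd
  have htp : (0:ℝ) < t := by exact_mod_cast ht
  set a : ℝ := 4 * t / (d * N ^ 2) with ha_def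
  have ha : 0 < a := by positivity
  set E : ℕ → ℝ := fun v => Real.exp (-a * (v:ℝ) ^ 2)
  have hEn : ∀ v, 0 ≤ E v := fun v => (Real.exp_pos _).le
  have hsmall : ∀ v : ℕ, 2 * v ≤ N → F v ≤ E v := by
    intro v hv
    have hv' : 2 * (v:ℝ) ≤ N := by exact_mod_cast hv
    have hx : |2 * Real.pi * v / N| ≤ Real.pi := by
      rw [abs_of_nonneg (by positivity), div_le_iff₀ hN]
      nlinarith [Real.pi_pos]
    have h := Real.cos_le_one_sub_mul_cos_sq hx
    have h2 : 2 / Real.pi ^ 2 * (2 * Real.pi * v / N) ^ 2 = 8 * v ^ 2 / N ^ 2 := by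
      field_simp
      ring
    rw [h2] at h
    simp only [F, E]
    apply Real.exp_le_exp.mpr
    have h3 : 8 * (v:ℝ) ^ 2 / N ^ 2 ≤ 1 - Real.cos (2 * Real.pi * v / N) := by linarith
    have h4 : -(t / (2 * (d : ℝ))) * (1 - Real.cos (2 * Real.pi * v / N))
       ≤ -(t / (2 * (d : ℝ))) * (8 * (v:ℝ) ^ 2 / N ^ 2) := by
      apply mul_le_mul_of_nonpos_left h3
      have : 0 < t / (2 * (d:ℝ)) := by positivity
      linarith
    refine h4.trans (le_of_eq ?_)
    rw [ha_def]
    field_simp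
    ring
  have hsym : ∀ v : ℕ, v ≤ N → F (N - v) = F v := by
    intro v hv
    simp only [F]
    congr 3
    rw [Nat.cast_sub hv]
    have : 2 * Real.pi * ((N:ℝ) - v) / N = 2 * Real.pi - 2 * Real.pi * v / N := by
      field_simp
    rw [this, Real.cos_two_pi_sub]
  have hF : ∀ v, v ≤ N → F v ≤ E v + E (N - v) := by
    intro v hv
    by_cases h : 2 * v ≤ N
    · linarith [hsmall v h, hEn (N - v)]
    · have := hsmall (N - v) (by omega)
      rw [hsym v hv] at this
      linarith [hEn v]
  have hsum : ∑ j : ZMod N, F j.val = ∑ v ∈ Finset.range N, F v := by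
    refine Finset.sum_nbij ZMod.val ?_ ?_ ?_ ?_
    · intro j _; simpa using ZMod.val_lt j
    · intro i _ j _ h; exact ZMod.val_injective N h
    · intro v hv
      simp only [Finset.coe_range, Set.mem_Iio] at hv
      exact ⟨(v : ZMod N), by simp, ZMod.val_cast_of_lt hv⟩
    · intro j _; rfl
  rw [show (∑ j : ZMod N, Real.exp (-(t / (2 * (d : ℝ))) * (1 - Real.cos (2 * Real.pi * j.val / N))))
    = ∑ j : ZMod N, F j.val from rfl, hsum]
  obtain ⟨m, rfl⟩ : ∃ m, N = m + 1 := ⟨N - 1, by omega⟩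
  rw [Finset.sum_range_succ']
  have hF0 : F 0 = 1 := by simp [F]
  have hg := gauss_sum a ha m
  have h1 : ∑ v ∈ Finset.range m, F (v + 1) ≤
      ∑ v ∈ Finset.range m, E (v + 1) + ∑ v ∈ Finset.range m, E (v + 1) := by
    conv_rhs => rw [← Finset.sum_range_reflect (fun v => E (v+1)) m]
    nth_rewrite 1 [Finset.sum_range_reflect (fun v => E (v+1)) m]
    rw [← Finset.sum_add_distrib]
    refine Finset.sum_le_sum fun v hv => ?_
    rw [Finset.mem_range] at hv
    have := hF (v + 1) (by omega)
    rwa [show m + 1 - (v + 1) = m - 1 - v + 1 by omega] at this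
  have h2 : ∑ v ∈ Finset.range m, E (v + 1) ≤ √(Real.pi / a) / 2 := hg
  have h3 : √(Real.pi / a) = ((m + 1 : ℕ) : ℝ) * √(Real.pi * d / (4 * t)) := by
    rw [← Real.sqrt_sq hN.le, ← Real.sqrt_mul (by positivity)]
    congr 1
    rw [ha_def]
    field_simp
  rw [← h3]
  linarith

lemma Pw_torus_bound (hd : 0 < d) (t : ℕ) (ht : 0 < t) (y : Fin d → ZMod N) :
    |Pw (eT d N) t y - ((N : ℝ) ^ d)⁻¹| ≤
      ((N : ℝ) ^ d)⁻¹ * ((1 + N * √(Real.pi * d / (4 * t))) ^ d - 1) := by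
  have hNp : 0 < N := Nat.pos_of_ne_zero (NeZero.ne N)
  have hN : (0:ℝ) < N := by exact_mod_cast hNp
  have h0 : phiT (0 : Fin d → ZMod N) = 1 := by
    rw [phiT_eq hd]; simp
  have hc0 : cT (0 : Fin d → ZMod N) y = 1 := by simp [cT]
  have hs : ∀ f : (Fin d → ZMod N) → ℝ, ∑ k, f k = f 0 + ∑ k ∈ Finset.univ.erase 0, f k := by
    intro f
    rw [Finset.add_sum_erase _ _ (Finset.mem_univ _)]
  rw [Pw_fourier, hs, h0, hc0]
  simp only [one_pow, mul_one, mul_add, add_sub_cancel_left]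
  rw [abs_mul, abs_of_pos (by positivity : (0:ℝ) < ((N : ℝ) ^ d)⁻¹)]
  gcongr
  have habs : ∀ k : Fin d → ZMod N, |phiT k ^ t * cT k y| ≤ phiT k ^ t := by
    intro k
    rw [abs_mul, abs_of_nonneg (pow_nonneg (phiT_nonneg hd k) t)]
    have : |cT k y| ≤ 1 := by
      rw [cT, std_re]; exact Real.abs_cos_le_one _
    exact mul_le_of_le_one_right (pow_nonneg (phiT_nonneg hd k) t) this
  calc |∑ k ∈ Finset.univ.erase 0, phiT k ^ t * cT k y|
      ≤ ∑ k ∈ Finset.univ.erase 0, |phiT k ^ t * cT k y| := Finset.abs_sum_le_sum_abs _ _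
    _ ≤ ∑ k ∈ Finset.univ.erase 0, phiT k ^ t := Finset.sum_le_sum fun k _ => habs k
    _ = ∑ k : Fin d → ZMod N, phiT k ^ t - 1 := by rw [hs (fun k => phiT k ^ t), h0]; simp
    _ ≤ _ := by
      gcongr
      calc ∑ k : Fin d → ZMod N, phiT k ^ t
        ≤ ∑ k : Fin d → ZMod N, ∏ i,
          Real.exp (-(t / (2 * (d : ℝ))) * (1 - Real.cos (2 * Real.pi * (k i).val / N))) :=
            Finset.sum_le_sum fun k _ => phiT_pow_le hd k t
        _ = (∑ j : ZMod N,
          Real.exp (-(t / (2 * (d : ℝ))) * (1 - Real.cos (2 * Real.pi * j.val / N)))) ^ d := by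
            rw [Fintype.sum_pow]
        _ ≤ _ := by
            gcongr
            exact theta_bound hd t ht

end fourier


section decay
variable {d : ℕ}

lemma torus_heat (hd : 0 < d) (N : ℕ) [NeZero N] (t : ℕ) (ht : 0 < t) (y : Fin d → ZMod N) :
    Pw (eT d N) t y ≤ ((N : ℝ)⁻¹ + √(Real.pi * d / (4 * t))) ^ d := by
  have hN : (0:ℝ) < N := by exact_mod_cast Nat.pos_of_ne_zero (NeZero.ne N)
  have h := (abs_le.mp (Pw_torus_bound hd t ht y)).2
  have : ((N : ℝ)⁻¹ + √(Real.pi * d / (4 * t))) ^ d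
      = ((N : ℝ) ^ d)⁻¹ * (1 + N * √(Real.pi * d / (4 * t))) ^ d := by
    rw [← inv_pow, ← mul_pow]
    congr 1
    field_simp
  rw [this]
  linarith

lemma torus_decay (hd : 0 < d) (B : ℝ) (hB : 0 ≤ B) : ∃ C : ℝ, 0 < C ∧
    ∀ (N : ℕ) [NeZero N] (t : ℕ) (y : Fin d → ZMod N), (t : ℝ) ≤ B * N ^ 2 →
      Pw (eT d N) t y ≤ C * ((√((t : ℝ) + 1))⁻¹) ^ d := by
  refine ⟨(√2 * (√B + √(Real.pi * d / 4))) ^ d + 1, by positivity, ?_⟩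
  intro N _ t y htB
  have hN : (0:ℝ) < N := by exact_mod_cast Nat.pos_of_ne_zero (NeZero.ne N)
  rcases Nat.eq_zero_or_pos t with rfl | ht
  · have h1 := Pw_le_one hd (eT d N) 0 y
    have : (0:ℝ) ≤ (√2 * (√B + √(Real.pi * d / 4))) ^ d := by positivity
    have h2 : ((√(((0:ℕ) : ℝ) + 1))⁻¹) ^ d = 1 := by simp
    rw [h2]
    linarith
  · have htp : (0:ℝ) < t := by exact_mod_cast ht
    have ht1 : (1:ℝ) ≤ t := by exact_mod_cast ht
    refine (torus_heat hd N t ht y).trans ?_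
    have h1 : (N : ℝ)⁻¹ ≤ √B * (√t)⁻¹ := by
      rw [← div_eq_mul_inv, le_div_iff₀ (by positivity), inv_mul_le_iff₀ hN]
      rw [← Real.sqrt_sq hN.le, ← Real.sqrt_mul (by positivity)]
      apply Real.sqrt_le_sqrt
      linarith
    have h2 : √(Real.pi * d / (4 * t)) = √(Real.pi * d / 4) * (√t)⁻¹ := by
      rw [← div_div, Real.sqrt_div (by positivity), div_eq_mul_inv]
    have h3 : (√(t:ℝ))⁻¹ ≤ √2 * (√((t:ℝ) + 1))⁻¹ := by
      rw [← div_eq_mul_inv, le_div_iff₀ (by positivity), inv_mul_le_iff₀ (by positivity),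
        ← Real.sqrt_mul (by positivity)]
      apply Real.sqrt_le_sqrt
      linarith
    have h4 : (N : ℝ)⁻¹ + √(Real.pi * d / (4 * t)) ≤
        (√2 * (√B + √(Real.pi * d / 4))) * (√((t:ℝ) + 1))⁻¹ := by
      rw [h2]
      calc (N : ℝ)⁻¹ + √(Real.pi * d / 4) * (√t)⁻¹
          ≤ (√B + √(Real.pi * d / 4)) * (√t)⁻¹ := by linarith
        _ ≤ (√B + √(Real.pi * d / 4)) * (√2 * (√((t:ℝ) + 1))⁻¹) := by gcongr
        _ = _ := by ring
    calc ((N : ℝ)⁻¹ + √(Real.pi * d / (4 * t))) ^ d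
        ≤ ((√2 * (√B + √(Real.pi * d / 4))) * (√((t:ℝ) + 1))⁻¹) ^ d := by gcongr
      _ = (√2 * (√B + √(Real.pi * d / 4))) ^ d * (√((t:ℝ) + 1))⁻¹ ^ d := mul_pow _ _ _
      _ ≤ _ := by gcongr; linarith

/-- projection -/
def proj (d N : ℕ) : (Fin d → ℤ) →+ (Fin d → ZMod N) where
  toFun x := fun i => (x i : ZMod N)
  map_zero' := by funext i; simp
  map_add' x y := by funext i; simp

lemma proj_apply (N : ℕ) (x : Fin d → ℤ) (i : Fin d) : proj d N x i = (x i : ZMod N) := rfl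

lemma proj_e (N : ℕ) (i : Fin d) : proj d N (eZ d i) = eT d N i := by
  funext j
  rw [proj_apply, eZ, eT]
  by_cases h : j = i
  · subst h; simp
  · simp [h]

lemma Pw_proj (N t : ℕ) (x : Fin d → ℤ) :
    (Mop (eZ d) ^ t) (fun x => Pw (eT d N) 0 (proj d N x)) x = Pw (eT d N) t (proj d N x) := by
  rw [Mop_pow_comp (eZ d) (eT d N) (proj d N) (proj_e N), ← Pw_eq]

lemma Pw_le_proj (N t : ℕ) (x : Fin d → ℤ) : Pw (eZ d) t x ≤ Pw (eT d N) t (proj d N x) := by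
  rw [← Pw_proj, Pw_eq]
  refine Mop_pow_mono _ _ (fun y => ?_) _
  rw [Pw_zero, Pw_zero]
  by_cases h : y = 0
  · simp [h]
  · simp only [h, if_false]
    split_ifs <;> norm_num

lemma Z_decay (hd : 0 < d) : ∃ C : ℝ, 0 < C ∧
    ∀ (t : ℕ) (y : Fin d → ℤ), Pw (eZ d) t y ≤ C * ((√((t : ℝ) + 1))⁻¹) ^ d := by
  obtain ⟨C, hC, h⟩ := torus_decay hd 1 zero_le_one
  refine ⟨C, hC, fun t y => (Pw_le_proj (t + 1) t y).trans (h (t + 1) t _ ?_)⟩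
  push_cast
  have : (0:ℝ) ≤ t := by positivity
  nlinarith

/-- squared Euclidean norm -/
def sq (x : Fin d → ℤ) : ℝ := ∑ i, (x i : ℝ) ^ 2

lemma sq_nonneg' (x : Fin d → ℤ) : 0 ≤ sq x := Finset.sum_nonneg fun _ _ => by positivity

lemma Mop_sq (hd : 0 < d) : Mop (eZ d) sq = sq + fun _ => (1 / 2 : ℝ) := by
  funext x
  rw [Mop_apply]
  have hdp : (d:ℝ) ≠ 0 := by positivity
  have : ∀ i, sq (x + eZ d i) + sq (x - eZ d i) = 2 * sq x + 2 := by
    intro i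
    simp only [sq]
    have h2 : ∀ j, (((x + eZ d i) j : ℤ) : ℝ) ^ 2 + (((x - eZ d i) j : ℤ) : ℝ) ^ 2
        = 2 * (x j : ℝ) ^ 2 + if j = i then 2 else 0 := by
      intro j
      by_cases h : j = i
      · subst h; simp [eZ]; ring
      · simp [eZ, h]; ring
    rw [← Finset.sum_add_distrib, Finset.mul_sum, Finset.sum_congr rfl fun j _ => h2 j,
      Finset.sum_add_distrib]
    simp
  simp only [this]
  simp
  field_simp
  ring

lemma Mop_pow_sq (hd : 0 < d) (t : ℕ) : (Mop (eZ d) ^ t) sq 0 = t / 2 := by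
  have h : ∀ t : ℕ, (Mop (eZ d) ^ t) sq = sq + fun _ => (t / 2 : ℝ) := by
    intro t
    induction t with
    | zero => funext x; simp
    | succ t ih =>
      rw [Mop_pow_succ, ih, map_add, Mop_sq hd, Mop_const hd]
      funext x
      simp
      ring
  rw [h]
  simp [sq]

lemma sq_ge (N : ℕ) (x : Fin d → ℤ) (hx : x ≠ 0) (hp : proj d N x = 0) : (N : ℝ) ^ 2 ≤ sq x := by
  obtain ⟨i, hi⟩ := Function.ne_iff.mp hx
  have h1 : ((x i : ℤ) : ZMod N) = 0 := by
    have := congrFun hp i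
    simpa [proj_apply] using this
  rw [ZMod.intCast_zmod_eq_zero_iff_dvd] at h1
  have h2 : (N : ℤ) ≤ |x i| := Int.le_of_dvd (abs_pos.mpr hi) ((dvd_abs _ _).mpr h1)
  have h3 : (N : ℝ) ≤ |(x i : ℝ)| := by exact_mod_cast h2
  calc (N : ℝ) ^ 2 ≤ |(x i : ℝ)| ^ 2 := by gcongr
    _ = (x i : ℝ) ^ 2 := sq_abs _
    _ ≤ sq x := Finset.single_le_sum (f := fun i => (x i : ℝ) ^ 2)
        (fun _ _ => by positivity) (Finset.mem_univ i)

/-- difference between torus and lattice return -/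
def Dn (d N : ℕ) (x : Fin d → ℤ) : ℝ := Pw (eT d N) 0 (proj d N x) - Pw (eZ d) 0 x

lemma Dn_pow (N t : ℕ) : (Mop (eZ d) ^ t) (Dn d N) 0 = Pw (eT d N) t 0 - Pw (eZ d) t 0 := by
  have : Dn d N = (fun x => Pw (eT d N) 0 (proj d N x)) - Pw (eZ d) 0 := rfl
  rw [this, map_sub, Pi.sub_apply, Pw_proj, ← Pw_eq, map_zero]

lemma Dn_eq (N : ℕ) (x : Fin d → ℤ) : Dn d N x = if x ≠ 0 ∧ proj d N x = 0 then 1 else 0 := by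
  rw [Dn, Pw_zero, Pw_zero]
  by_cases h : x = 0
  · simp [h]
  · simp [h]

lemma diff_simple (hd : 0 < d) (N t : ℕ) (hN : 0 < N) :
    Pw (eT d N) t 0 - Pw (eZ d) t 0 ≤ t / (2 * N ^ 2) := by
  have hN' : (0:ℝ) < N := by exact_mod_cast hN
  rw [← Dn_pow]
  have h := Mop_pow_mono (eZ d) t (f := Dn d N) (g := ((N:ℝ)^2)⁻¹ • sq) (fun x => by
    rw [Dn_eq, Pi.smul_apply, smul_eq_mul]
    split_ifs with hx
    · have := sq_ge N x hx.1 hx.2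
      rw [inv_mul_eq_div, le_div_iff₀ (by positivity)]
      linarith
    · have := sq_nonneg' x
      positivity) 0
  rw [map_smul, Pi.smul_apply, Mop_pow_sq hd, smul_eq_mul] at h
  refine h.trans (le_of_eq ?_)
  field_simp

lemma diff_half (hd : 0 < d) (N s t : ℕ) (hN : 0 < N) (bs bt : ℝ)
    (hs : ∀ y, Pw (eT d N) s y ≤ bs) (ht : ∀ y, Pw (eT d N) t y ≤ bt) :
    Pw (eT d N) (s + t) 0 - Pw (eZ d) (s + t) 0 ≤ (s * bt + t * bs) / N ^ 2 := by
  have hN' : (0:ℝ) < N := by exact_mod_cast hN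
  rw [← Dn_pow, Mop_pow_add_apply]
  set I : (Fin d → ℤ) → ℝ := fun x => Pw (eT d N) 0 (proj d N x) with hI
  have hI0 : ∀ x, 0 ≤ I x := fun x => Pw_nonneg _ _ _
  set c : ℝ := 2 / N ^ 2 with hc
  have hc0 : 0 ≤ c := by positivity
  have hD : ∀ y z : Fin d → ℤ, Dn d N (y + z) ≤ c * (sq y * I (y + z)) + c * (sq z * I (y + z)) := by
    intro y z
    have hrhs : 0 ≤ c * (sq y * I (y + z)) + c * (sq z * I (y + z)) := by
      have := sq_nonneg' y
      have := sq_nonneg' z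
      have := hI0 (y + z)
      positivity
    rw [Dn_eq]
    split_ifs with hx
    · have h1 := sq_ge N _ hx.1 hx.2
      have h2 : sq (y + z) ≤ 2 * sq y + 2 * sq z := by
        simp only [sq, Finset.mul_sum, ← Finset.sum_add_distrib]
        refine Finset.sum_le_sum fun i _ => ?_
        rw [Pi.add_apply]
        push_cast
        nlinarith [sq_nonneg ((y i : ℝ) - z i)]
      have h3 : I (y + z) = 1 := by simp [hI, Pw_zero, hx.2]
      rw [h3, hc]
      have : 2 / (N:ℝ) ^ 2 * (sq y * 1) + 2 / (N:ℝ) ^ 2 * (sq z * 1) = (2 * sq y + 2 * sq z) / N ^ 2 := by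
        ring
      rw [this, le_div_iff₀ (by positivity)]
      linarith
    · exact hrhs
  have hIE : ∀ (r : ℕ) (y : Fin d → ℤ), (Mop (eZ d) ^ r) (fun z => I (y + z)) 0
      = Pw (eT d N) r (proj d N y) := by
    intro r y
    rw [Mop_pow_trans, hI, Pw_proj, add_zero]
  have hlin : ∀ (r : ℕ) (a : ℝ) (f : (Fin d → ℤ) → ℝ) (x : Fin d → ℤ),
      (Mop (eZ d) ^ r) (fun z => a * f z) x = a * (Mop (eZ d) ^ r) f x := by
    intro r a f x
    have := (Mop (eZ d) ^ r).map_smul a f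
    exact congrFun this x
  have hadd : ∀ (r : ℕ) (f g : (Fin d → ℤ) → ℝ) (x : Fin d → ℤ),
      (Mop (eZ d) ^ r) (fun z => f z + g z) x
        = (Mop (eZ d) ^ r) f x + (Mop (eZ d) ^ r) g x := by
    intro r f g x
    exact congrFun ((Mop (eZ d) ^ r).map_add f g) x
  -- one-sided bound
  have one : ∀ (r q : ℕ) (b : ℝ), (∀ y, Pw (eT d N) q y ≤ b) →
      (Mop (eZ d) ^ r) (fun y => (Mop (eZ d) ^ q) (fun z => c * (sq y * I (y + z))) 0) 0
        ≤ r * b / N ^ 2 := by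
    intro r q b hb
    have h1 : ∀ y : Fin d → ℤ, (Mop (eZ d) ^ q) (fun z => c * (sq y * I (y + z))) 0
        ≤ c * b * sq y := by
      intro y
      rw [hlin q c (fun z => sq y * I (y + z)), hlin q (sq y) (fun z => I (y + z)), hIE]
      have := sq_nonneg' y
      calc c * (sq y * Pw (eT d N) q (proj d N y)) ≤ c * (sq y * b) := by gcongr; exact hb _
        _ = _ := by ring
    refine (Mop_pow_mono (eZ d) r h1 0).trans (le_of_eq ?_)
    rw [hlin r (c * b) sq, Mop_pow_sq hd, hc]
    field_simp
  have hmono := Mop_pow_mono (eZ d) s (fun y => Mop_pow_mono (eZ d) t (fun z => hD y z) 0) 0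
  refine hmono.trans ?_
  have hsplit : (fun y => (Mop (eZ d) ^ t) (fun z => c * (sq y * I (y + z)) + c * (sq z * I (y + z))) 0)
      = fun y => (Mop (eZ d) ^ t) (fun z => c * (sq y * I (y + z))) 0
        + (Mop (eZ d) ^ t) (fun z => c * (sq z * I (y + z))) 0 := by
    funext y
    exact hadd t _ _ 0
  rw [hsplit, hadd s (fun y => (Mop (eZ d) ^ t) (fun z => c * (sq y * I (y + z))) 0)
    (fun y => (Mop (eZ d) ^ t) (fun z => c * (sq z * I (y + z))) 0),
    Mop_fubini (eZ d) s t (fun y z => c * (sq z * I (y + z)))]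
  have h1 := one s t bt ht
  have h2 := one t s bs hs
  have h3 : (s * bt + t * bs) / (N:ℝ) ^ 2 = s * bt / N ^ 2 + t * bs / N ^ 2 := by ring
  rw [h3]
  refine add_le_add h1 ?_
  have h4 : (fun z : Fin d → ℤ => (Mop (eZ d) ^ s) (fun y => c * (sq z * I (y + z))) 0)
      = (fun z => (Mop (eZ d) ^ s) (fun y => c * (sq z * I (z + y))) 0) := by
    funext z
    have h5 : (fun y : Fin d → ℤ => c * (sq z * I (y + z))) = fun y => c * (sq z * I (z + y)) := by
      funext y
      rw [add_comm]
    rw [h5]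
  rw [h4]
  exact h2

end decay


section tmix
variable {d : ℕ}

lemma phiT_single (hd : 0 < d) (N : ℕ) [NeZero N] (hN : 3 ≤ N) :
    1 - 10 / (N : ℝ) ^ 2 ≤ phiT (Pi.single (⟨0, hd⟩ : Fin d) (1 : ZMod N)) := by
  have hN' : (3:ℝ) ≤ N := by exact_mod_cast hN
  have hd' : (1:ℝ) ≤ d := by exact_mod_cast hd
  haveI : Fact (1 < N) := ⟨by omega⟩
  rw [phiT_eq hd, Finset.sum_eq_single (⟨0, hd⟩ : Fin d)]
  · rw [Pi.single_eq_same, ZMod.val_one]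
    have h1 := Real.one_sub_sq_div_two_le_cos (x := 2 * Real.pi * ((1:ℕ):ℝ) / N)
    have h2 : 1 - Real.cos (2 * Real.pi * ((1:ℕ):ℝ) / N) ≤ 2 * Real.pi ^ 2 / N ^ 2 := by
      have : (2 * Real.pi * ((1:ℕ):ℝ) / N) ^ 2 / 2 = 2 * Real.pi ^ 2 / N ^ 2 := by
        push_cast
        field_simp
        try ring
      linarith
    have h3 : Real.pi ^ 2 ≤ 10 := by
      have := Real.pi_lt_d2
      have := Real.pi_pos
      nlinarith
    have h4 : (1 / (2 * (d : ℝ))) * (1 - Real.cos (2 * Real.pi * ((1:ℕ):ℝ) / N))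
        ≤ (1 / 2) * (2 * 10 / N ^ 2) := by
      apply mul_le_mul
      · apply one_div_le_one_div_of_le (by norm_num); linarith
      · refine h2.trans ?_
        gcongr
      · have := Real.cos_le_one (2 * Real.pi * ((1:ℕ):ℝ) / N)
        linarith
      · norm_num
    have h5 : (1 / 2 : ℝ) * (2 * 10 / N ^ 2) = 10 / N ^ 2 := by ring
    linarith
  · intro b _ hb
    rw [Pi.single_eq_of_ne hb]
    simp
  · simp

lemma unif_torus (N : ℕ) [NeZero N] : unif (Fin d → ZMod N) = ((N : ℝ) ^ d)⁻¹ := by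
  simp [unif, ZMod.card]

lemma mix_iff (hd : 0 < d) (N : ℕ) [NeZero N] (hN : 3 ≤ N) (t : ℕ) :
    (∀ x y : Fin d → ZMod N, |Kpow (torus d N) t x y / unif (Fin d → ZMod N) - 1| ≤ 1 / 4) ↔
      ∀ y : Fin d → ZMod N, |Pw (eT d N) t y - ((N : ℝ) ^ d)⁻¹| ≤ ((N : ℝ) ^ d)⁻¹ * (1 / 4) := by
  have hN' : (0:ℝ) < (N : ℝ) ^ d := by
    have : 0 < N := by omega
    positivity
  have key : ∀ a : ℝ, |a / ((N : ℝ) ^ d)⁻¹ - 1| ≤ 1 / 4 ↔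
      |a - ((N : ℝ) ^ d)⁻¹| ≤ ((N : ℝ) ^ d)⁻¹ * (1 / 4) := by
    intro a
    have : a / ((N : ℝ) ^ d)⁻¹ - 1 = (N:ℝ)^d * (a - ((N : ℝ) ^ d)⁻¹) := by
      field_simp
    rw [this, abs_mul, abs_of_pos hN', inv_mul_eq_div, le_div_iff₀ hN', mul_comm]
  simp only [unif_torus, torus_Kpow hd hN, key]
  constructor
  · intro h y
    have := h 0 y
    rwa [sub_zero] at this
  · intro h x y
    exact h (y - x)

lemma mix_lower (hd : 0 < d) (N : ℕ) [NeZero N] (hN : 3 ≤ N) (t : ℕ)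
    (h : ∀ y : Fin d → ZMod N, |Pw (eT d N) t y - ((N : ℝ) ^ d)⁻¹| ≤ ((N : ℝ) ^ d)⁻¹ * (1 / 4)) :
    (N : ℝ) ^ 2 ≤ 14 * t := by
  have hN' : (3:ℝ) ≤ N := by exact_mod_cast hN
  have hNd : (0:ℝ) < (N : ℝ) ^ d := by positivity
  haveI : Fact (1 < N) := ⟨by omega⟩
  set k : Fin d → ZMod N := Pi.single (⟨0, hd⟩ : Fin d) (1 : ZMod N) with hk
  have hk0 : k ≠ 0 := by
    intro h0
    have := congrFun h0 ⟨0, hd⟩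
    rw [hk, Pi.single_eq_same] at this
    exact one_ne_zero this
  have h0 : ∑ y, cT k y = 0 := by
    have : ∀ y, cT k y = cT y k := fun y => by rw [cT, cT, dotProduct_comm]
    simp only [this]
    rw [sum_cT]
    simp [hk0]
  have h1 : ∑ y, Pw (eT d N) t y * cT k y = phiT k ^ t := by
    have := (hasSum_fintype (fun y => Pw (eT d N) t y * cT k y)).unique (hasSum_Pw (eT d N) t (cT k))
    rw [this, Mop_pow_cT]
    simp [cT]
  have h2 : phiT k ^ t ≤ 1 / 4 := by
    rw [← h1]
    have : ∑ y, Pw (eT d N) t y * cT k y = ∑ y, (Pw (eT d N) t y - ((N : ℝ) ^ d)⁻¹) * cT k y := by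
      simp only [sub_mul, Finset.sum_sub_distrib, ← Finset.mul_sum, h0]
      simp
    rw [this]
    calc _ ≤ ∑ y : Fin d → ZMod N, ((N : ℝ) ^ d)⁻¹ * (1 / 4) := by
          apply Finset.sum_le_sum
          intro y _
          refine (le_abs_self _).trans ?_
          rw [abs_mul]
          have h3 : |cT k y| ≤ 1 := by rw [cT, std_re]; exact Real.abs_cos_le_one _
          exact (mul_le_of_le_one_right (abs_nonneg _) h3).trans (h y)
      _ = 1 / 4 := by
          simp [ZMod.card]
          field_simp
  have h3 := phiT_single hd N hN
  rw [← hk] at h3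
  have h4 := one_add_mul_le_pow (a := phiT k - 1) (by have := phiT_nonneg hd k; linarith) t
  rw [add_sub_cancel] at h4
  have h5 : (t:ℝ) * (-(10 / (N:ℝ)^2)) ≤ t * (phiT k - 1) := by
    gcongr; linarith
  have h6 : 3 / 4 ≤ (t:ℝ) * (10 / (N:ℝ)^2) := by linarith
  rw [← mul_div_assoc, le_div_iff₀ (by positivity)] at h6
  have : (0:ℝ) ≤ t := by positivity
  nlinarith

lemma exists_mixC (d : ℕ) : ∃ C : ℕ, 0 < C ∧
    (1 + √(Real.pi * d / (4 * C))) ^ d - 1 ≤ 1 / 4 := by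
  have h : Tendsto (fun C : ℕ => (1 + √(Real.pi * d / (4 * (C:ℝ)))) ^ d - 1) atTop (nhds ((1 + √0) ^ d - 1)) := by
    refine ((Tendsto.const_add 1 ?_).pow d).sub_const 1
    refine (Real.continuous_sqrt.tendsto _).comp ?_
    apply Tendsto.const_div_atTop
    exact Tendsto.const_mul_atTop (by norm_num) tendsto_natCast_atTop_atTop
  have h2 : ((1 + √0) ^ d - 1 : ℝ) < 1 / 4 := by simp
  obtain ⟨C, hC, hC2⟩ := ((h.eventually (gt_mem_nhds h2)).and (eventually_gt_atTop 0)).exists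
  exact ⟨C, hC2, hC.le⟩

lemma Tmix_bounds (hd : 0 < d) : ∃ C : ℕ, 0 < C ∧ ∀ N : ℕ, 3 ≤ N → ∀ [NeZero N],
    Tmix (torus d N) ≤ C * N ^ 2 ∧ (N : ℝ) ^ 2 ≤ 14 * (Tmix (torus d N) : ℝ) := by
  obtain ⟨C, hC, hC2⟩ := exists_mixC d
  refine ⟨C, hC, fun N hN _ => ?_⟩
  have hNp : 0 < N := by omega
  have hNR : (0:ℝ) < N := by exact_mod_cast hNp
  have hmem : C * N ^ 2 ∈ {t : ℕ | ∀ x y : Fin d → ZMod N,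
      |Kpow (torus d N) t x y / unif (Fin d → ZMod N) - 1| ≤ 1 / 4} := by
    rw [Set.mem_setOf_eq, mix_iff hd N hN]
    intro y
    refine (Pw_torus_bound hd (C * N ^ 2) (by positivity) y).trans ?_
    have : (N:ℝ) * √(Real.pi * d / (4 * ((C * N ^ 2 : ℕ):ℝ))) = √(Real.pi * d / (4 * C)) := by
      have h1 : Real.pi * d / (4 * ((C * N ^ 2 : ℕ):ℝ)) = (Real.pi * d / (4 * C)) / N ^ 2 := by
        push_cast
        rw [div_div]
        congr 1
        ring
      rw [h1, Real.sqrt_div' _ (by positivity), Real.sqrt_sq hNR.le]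
      field_simp
    rw [this]
    gcongr
  refine ⟨Nat.sInf_le hmem, ?_⟩
  have h2 := Nat.sInf_mem ⟨_, hmem⟩
  rw [Set.mem_setOf_eq, mix_iff hd N hN] at h2
  exact mix_lower hd N hN _ h2

end tmix


section sandwich
variable {d : ℕ}

/-- truncated Green function -/
def gP {A : Type*} [AddCommGroup A] (e : Fin d → A) (T : ℕ) (y : A) : ℝ :=
  ∑ s ∈ Finset.range (T + 1), Pw e s y

/-- double sum -/
def SP {A : Type*} [AddCommGroup A] (e : Fin d → A) (T : ℕ) : ℝ :=
  ∑ s ∈ Finset.range (T + 1), ∑ t ∈ Finset.range (T + 1), Pw e (s + t) 0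

lemma gP_nonneg {A : Type*} [AddCommGroup A] (e : Fin d → A) (T : ℕ) (y : A) : 0 ≤ gP e T y :=
  Finset.sum_nonneg fun _ _ => Pw_nonneg _ _ _

lemma gP_sum {A : Type*} [AddCommGroup A] (hd : 0 < d) (e : Fin d → A) (T : ℕ) :
    HasSum (fun y => gP e T y) (T + 1) := by
  have := hasSum_sum (s := Finset.range (T + 1)) (fun s _ => Pw_sum_one hd e s)
  simpa [gP] using this

lemma gP_sq {A : Type*} [AddCommGroup A] (e : Fin d → A) (T : ℕ) :
    HasSum (fun y => gP e T y ^ 2) (SP e T) := by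
  have := hasSum_sum (s := Finset.range (T + 1)) (fun s _ =>
    hasSum_sum (s := Finset.range (T + 1)) (fun t _ => Pw_add e s t))
  convert this using 2 with y
  · rw [pow_two, gP, Finset.sum_mul_sum]
  · rfl

lemma one_le_gP {A : Type*} [AddCommGroup A] (e : Fin d → A) (T : ℕ) : 1 ≤ gP e T 0 := by
  have := Finset.single_le_sum (f := fun s => Pw e s 0) (s := Finset.range (T + 1))
    (fun s _ => Pw_nonneg e s 0) (Finset.mem_range.mpr (Nat.succ_pos T))
  simpa [gP, Pw_zero] using this

lemma Fquad_eq [Nonempty V] (G : SimpleGraph V) (c : ℝ) :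
    Fquad G c = ∑ x, ∑ y, fnc G c x y ^ 2
      - (∑ x, ∑ y, fnc G c x y) ^ 2 / (Fintype.card V : ℝ) ^ 2 := by
  have hc : (Fintype.card V : ℝ) ≠ 0 := by exact_mod_cast Fintype.card_ne_zero
  rw [Fquad]
  have : ∀ x y, (fnc G c x y - fbar G c) ^ 2
      = fnc G c x y ^ 2 - 2 * fbar G c * fnc G c x y + fbar G c ^ 2 := fun x y => by ring
  simp only [this, Finset.sum_add_distrib, Finset.sum_sub_distrib, ← Finset.mul_sum]
  rw [fbar]
  simp only [Finset.sum_const, Finset.card_univ, nsmul_eq_mul]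
  field_simp
  ring

lemma gT_torus (hd : 0 < d) (N : ℕ) [NeZero N] (hN : 3 ≤ N) (T : ℕ) (x y : Fin d → ZMod N) :
    gT (torus d N) T x y = gP (eT d N) T (y - x) := by
  simp only [gT, gP, torus_Kpow hd hN]

lemma sum_trans (N : ℕ) [NeZero N] (h : (Fin d → ZMod N) → ℝ) :
    ∑ x : Fin d → ZMod N, ∑ y, h (y - x) = (N:ℝ) ^ d * ∑ y, h y := by
  have : ∀ x : Fin d → ZMod N, ∑ y, h (y - x) = ∑ y, h y := fun x =>
    Equiv.sum_comp (Equiv.subRight x) h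
  simp [this, ZMod.card]

lemma Fquad_sandwich (hd : 0 < d) (N : ℕ) [NeZero N] (hN : 3 ≤ N) (c : ℝ) (T : ℕ)
    (hT : T = ⌊c * (Tmix (torus d N) : ℝ)⌋₊) :
    (N:ℝ) ^ d * SP (eT d N) T / gP (eT d N) T 0 ^ 2 - (2 * T + 1) ^ 2 ≤ Fquad (torus d N) c ∧
    Fquad (torus d N) c ≤ (N:ℝ) ^ d * SP (eT d N) (T + T) / gP (eT d N) T 0 ^ 2 := by
  have hNp : 0 < N := by omega
  have hNR : (0:ℝ) < N := by exact_mod_cast hNp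
  set g := gP (eT d N) T 0 with hg
  have hg1 : 1 ≤ g := one_le_gP _ _
  have hlow : ∀ x y, gP (eT d N) T (y - x) / g ≤ fnc (torus d N) c x y := by
    intro x y
    have := hit_lower (torus d N) (torus_K_sum hd hN) x y T
    rw [gT_torus hd N hN, gT_torus hd N hN, sub_self, ← hg] at this
    rw [div_le_iff₀ (by linarith), fnc, ← hT]
    linarith
  have hup : ∀ x y, fnc (torus d N) c x y ≤ gP (eT d N) (T + T) (y - x) / g := by
    intro x y
    have := hit_upper (torus d N) (torus_K_sum hd hN) x y T T
    rw [gT_torus hd N hN, gT_torus hd N hN, sub_self, ← hg] at this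
    rw [le_div_iff₀ (by linarith), fnc, ← hT]
    linarith
  have hnn : ∀ x y, 0 ≤ fnc (torus d N) c x y := fun x y =>
    (div_nonneg (gP_nonneg _ _ _) (by linarith)).trans (hlow x y)
  have hsq : ∀ S, ∑ y, (gP (eT d N) S y / g) ^ 2 = SP (eT d N) S / g ^ 2 := by
    intro S
    simp only [div_pow]
    rw [← Finset.sum_div, (hasSum_fintype _).unique (gP_sq (eT d N) S)]
  have hcard : (Fintype.card (Fin d → ZMod N) : ℝ) = (N:ℝ) ^ d := by simp [ZMod.card]
  rw [Fquad_eq, hcard]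
  have h1 : ∑ x, ∑ y, fnc (torus d N) c x y ^ 2 ≤ (N:ℝ) ^ d * SP (eT d N) (T + T) / g ^ 2 := by
    calc _ ≤ ∑ x : Fin d → ZMod N, ∑ y, (gP (eT d N) (T + T) (y - x) / g) ^ 2 := by
          gcongr with x _ y _
          · exact hnn x y
          · exact hup x y
      _ = _ := by
          rw [sum_trans N (fun z => (gP (eT d N) (T + T) z / g) ^ 2), hsq, mul_div_assoc]
  have h2 : (N:ℝ) ^ d * SP (eT d N) T / g ^ 2 ≤ ∑ x, ∑ y, fnc (torus d N) c x y ^ 2 := by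
    calc _ = ∑ x : Fin d → ZMod N, ∑ y, (gP (eT d N) T (y - x) / g) ^ 2 := by
          rw [sum_trans N (fun z => (gP (eT d N) T z / g) ^ 2), hsq, mul_div_assoc]
      _ ≤ _ := by
          gcongr with x _ y _
          · exact div_nonneg (gP_nonneg _ _ _) (by linarith)
          · exact hlow x y
  have h3 : ∑ x, ∑ y, fnc (torus d N) c x y ≤ (N:ℝ) ^ d * (2 * T + 1) := by
    calc _ ≤ ∑ x : Fin d → ZMod N, ∑ y, gP (eT d N) (T + T) (y - x) := by
          gcongr with x _ y _
          exact (hup x y).trans (div_le_self (gP_nonneg _ _ _) hg1)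
      _ = _ := by
          rw [sum_trans N (fun z => gP (eT d N) (T + T) z),
            (hasSum_fintype _).unique (gP_sum hd (eT d N) (T + T))]
          push_cast
          ring
  have h4 : (∑ x, ∑ y, fnc (torus d N) c x y) ^ 2 / ((N:ℝ) ^ d) ^ 2 ≤ (2 * T + 1) ^ 2 := by
    rw [div_le_iff₀ (by positivity), ← mul_pow]
    have h0 : 0 ≤ ∑ x, ∑ y, fnc (torus d N) c x y :=
      Finset.sum_nonneg fun x _ => Finset.sum_nonneg fun y _ => hnn x y
    apply pow_le_pow_left₀ h0
    linarith
  constructor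
  · linarith
  · have : 0 ≤ (∑ x, ∑ y, fnc (torus d N) c x y) ^ 2 / ((N:ℝ) ^ d) ^ 2 := by positivity
    linarith

end sandwich


section limits
variable {d : ℕ}

lemma inv_sqrt_pow_le (hd : 4 ≤ d) (t : ℕ) : ((√((t:ℝ) + 1))⁻¹) ^ d ≤ 1 / ((t:ℝ) + 1) ^ 2 := by
  have h1 : (1:ℝ) ≤ √((t:ℝ) + 1) := by
    rw [Real.one_le_sqrt]
    have : (0:ℝ) ≤ t := by positivity
    linarith
  have h2 : ((√((t:ℝ) + 1))⁻¹) ^ d ≤ ((√((t:ℝ) + 1))⁻¹) ^ 4 :=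
    pow_le_pow_of_le_one (by positivity) (inv_le_one_of_one_le₀ h1) hd
  refine h2.trans (le_of_eq ?_)
  rw [inv_pow, show (4:ℕ) = 2 * 2 from rfl, pow_mul, Real.sq_sqrt (by positivity), one_div]

lemma summable_inv_sq : Summable (fun t : ℕ => 1 / ((t:ℝ) + 1) ^ 2) := by
  have := (summable_nat_add_iff 1).mpr (Real.summable_one_div_nat_pow.mpr (one_lt_two))
  simpa using this

lemma Z_decay4 (hd : 4 ≤ d) : ∃ C : ℝ, 0 < C ∧
    ∀ (t : ℕ) (y : Fin d → ℤ), Pw (eZ d) t y ≤ C / ((t:ℝ) + 1) ^ 2 := by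
  obtain ⟨C, hC, h⟩ := Z_decay (d := d) (by omega)
  refine ⟨C, hC, fun t y => (h t y).trans ?_⟩
  rw [div_eq_mul_one_div]
  gcongr
  exact inv_sqrt_pow_le hd t

lemma torus_decay4 (hd : 4 ≤ d) (B : ℝ) (hB : 0 ≤ B) : ∃ C : ℝ, 0 < C ∧
    ∀ (N : ℕ) [NeZero N] (t : ℕ) (y : Fin d → ZMod N), (t:ℝ) ≤ B * (N:ℝ) ^ 2 →
      Pw (eT d N) t y ≤ C / ((t:ℝ) + 1) ^ 2 := by
  obtain ⟨C, hC, h⟩ := torus_decay (d := d) (by omega) B hB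
  refine ⟨C, hC, fun N _ t y ht => (h N t y ht).trans ?_⟩
  rw [div_eq_mul_one_div]
  gcongr
  exact inv_sqrt_pow_le hd t

lemma summable_PwZ (hd : 4 ≤ d) (y : Fin d → ℤ) : Summable (fun t => Pw (eZ d) t y) := by
  obtain ⟨C, hC, h⟩ := Z_decay4 hd
  refine Summable.of_nonneg_of_le (fun t => Pw_nonneg _ _ _) (fun t => h t y) ?_
  simpa only [div_eq_mul_one_div C] using summable_inv_sq.mul_left C

lemma greenZ_hasSum (hd : 4 ≤ d) (y : Fin d → ℤ) :
    HasSum (fun t => Pw (eZ d) t y) (greenZ d y) := by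
  have := (summable_PwZ hd y).hasSum
  simpa only [greenZ, KZpow_eq] using this

lemma gP_le_greenZ (hd : 4 ≤ d) (T : ℕ) (y : Fin d → ℤ) : gP (eZ d) T y ≤ greenZ d y :=
  sum_le_hasSum _ (fun t _ => Pw_nonneg _ _ _) (greenZ_hasSum hd y)

lemma greenZ_nonneg (hd : 4 ≤ d) (y : Fin d → ℤ) : 0 ≤ greenZ d y :=
  (gP_nonneg _ 0 _).trans (gP_le_greenZ hd 0 y)

lemma one_le_greenZ (hd : 4 ≤ d) : 1 ≤ greenZ d 0 :=
  (one_le_gP _ 0).trans (gP_le_greenZ hd 0 0)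

lemma Pw_Z_le_T (N t : ℕ) : Pw (eZ d) t 0 ≤ Pw (eT d N) t 0 := by
  have := Pw_le_proj (d := d) N t 0
  rwa [map_zero] at this

lemma Pw_tendsto (hd : 0 < d) (t : ℕ) :
    Tendsto (fun n : ℕ => Pw (eT d (n + 1)) t 0) atTop (nhds (Pw (eZ d) t 0)) := by
  have h1 : Tendsto (fun n : ℕ => Pw (eZ d) t 0 + (t:ℝ) / (2 * ((n + 1 : ℕ):ℝ) ^ 2)) atTop
      (nhds (Pw (eZ d) t 0 + 0)) := by
    refine Tendsto.const_add _ (Tendsto.const_div_atTop ?_ _)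
    refine Tendsto.const_mul_atTop (by norm_num) ?_
    refine (tendsto_pow_atTop (by norm_num)).comp ?_
    exact tendsto_natCast_atTop_atTop.comp (tendsto_add_atTop_nat 1)
  rw [add_zero] at h1
  refine tendsto_of_tendsto_of_tendsto_of_le_of_le tendsto_const_nhds h1
    (fun n => Pw_Z_le_T _ _) (fun n => ?_)
  have := diff_simple hd (n + 1) t (Nat.succ_pos n)
  show Pw (eT d (n + 1)) t 0 ≤ _
  linarith

lemma gP_tendsto (hd : 4 ≤ d) (T : ℕ → ℕ) (hT : Tendsto T atTop atTop) (B : ℝ) (hB : 0 ≤ B)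
    (hTB : ∀ᶠ n in atTop, (T n : ℝ) ≤ B * ((n + 1 : ℕ) : ℝ) ^ 2) :
    Tendsto (fun n => gP (eT d (n + 1)) (T n) 0) atTop (nhds (greenZ d 0)) := by
  obtain ⟨C, hC, h⟩ := torus_decay4 hd B hB
  have h1 : ∀ n, gP (eT d (n + 1)) (T n) 0
      = ∑' t, if t ∈ Finset.range (T n + 1) then Pw (eT d (n + 1)) t 0 else 0 := by
    intro n
    rw [tsum_eq_sum (s := Finset.range (T n + 1)) (fun b hb => by simp only [hb, if_false]), gP]
    refine Finset.sum_congr rfl fun x hx => by simp only [hx, if_true]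
  simp only [h1]
  rw [← (greenZ_hasSum hd 0).tsum_eq]
  refine tendsto_tsum_of_dominated_convergence (bound := fun t : ℕ => C * (1 / ((t:ℝ) + 1) ^ 2))
    (summable_inv_sq.mul_left C) ?_ ?_
  · intro t
    refine (Pw_tendsto (by omega) t).congr' ?_
    filter_upwards [hT.eventually_ge_atTop t] with n hn
    rw [if_pos (Finset.mem_range.mpr (by omega))]
  · filter_upwards [hTB] with n hn t
    split_ifs with ht
    · rw [Real.norm_of_nonneg (Pw_nonneg _ _ _), ← div_eq_mul_one_div]
      apply h
      have : (t:ℝ) ≤ T n := by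
        exact_mod_cast Nat.lt_succ_iff.mp (Finset.mem_range.mp ht)
      linarith
    · rw [norm_zero]
      positivity

lemma five_bound (s t : ℕ) (hd : 5 ≤ d) : ((√(((s + t : ℕ):ℝ) + 1))⁻¹) ^ d
    ≤ ((s:ℝ) + 1) ^ (-(5/4) : ℝ) * ((t:ℝ) + 1) ^ (-(5/4) : ℝ) := by
  set x : ℝ := ((s + t : ℕ):ℝ) + 1 with hx
  have hx1 : 1 ≤ x := by
    have : (0:ℝ) ≤ ((s + t : ℕ):ℝ) := by positivity
    linarith
  have h1 : (1:ℝ) ≤ √x := by rwa [Real.one_le_sqrt]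
  have h2 : ((√x)⁻¹) ^ d ≤ ((√x)⁻¹) ^ 5 :=
    pow_le_pow_of_le_one (by positivity) (inv_le_one_of_one_le₀ h1) hd
  refine h2.trans ?_
  have h3 : ((√x)⁻¹) ^ 5 = (x ^ 2) ^ (-(5/4) : ℝ) := by
    rw [← Real.rpow_natCast x 2, ← Real.rpow_mul (by linarith), Real.sqrt_eq_rpow,
      ← Real.rpow_neg (by linarith), ← Real.rpow_natCast, ← Real.rpow_mul (by linarith)]
    norm_num
  rw [h3, ← Real.mul_rpow (by positivity) (by positivity)]
  apply Real.rpow_le_rpow_of_nonpos (by positivity) _ (by norm_num)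
  rw [hx]
  push_cast
  have hs : (0:ℝ) ≤ s := by positivity
  have ht : (0:ℝ) ≤ t := by positivity
  nlinarith [mul_nonneg hs ht]

lemma summable_five : Summable (fun p : ℕ × ℕ =>
    ((p.1:ℝ) + 1) ^ (-(5/4) : ℝ) * ((p.2:ℝ) + 1) ^ (-(5/4) : ℝ)) := by
  have h : Summable (fun n : ℕ => ((n:ℝ) + 1) ^ (-(5/4) : ℝ)) := by
    have := (summable_nat_add_iff 1).mpr (Real.summable_nat_rpow (p := -(5/4)) |>.mpr (by norm_num))
    simpa using this
  exact h.mul_of_nonneg h (fun _ => by positivity) (fun _ => by positivity)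

lemma SP_tendsto5 (hd : 5 ≤ d) (T : ℕ → ℕ) (hT : Tendsto T atTop atTop) (B : ℝ) (hB : 0 ≤ B)
    (hTB : ∀ᶠ n in atTop, (T n : ℝ) ≤ B * ((n + 1 : ℕ) : ℝ) ^ 2) :
    Tendsto (fun n => SP (eT d (n + 1)) (T n)) atTop
      (nhds (∑' p : ℕ × ℕ, Pw (eZ d) (p.1 + p.2) 0)) := by
  obtain ⟨C, hC, h⟩ := torus_decay (d := d) (by omega) (2 * B) (by positivity)
  have h1 : ∀ n, SP (eT d (n + 1)) (T n)
      = ∑' p : ℕ × ℕ, if p ∈ Finset.range (T n + 1) ×ˢ Finset.range (T n + 1)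
        then Pw (eT d (n + 1)) (p.1 + p.2) 0 else 0 := by
    intro n
    rw [tsum_eq_sum (s := Finset.range (T n + 1) ×ˢ Finset.range (T n + 1))
      (fun b hb => by simp only [hb, if_false]), SP, ← Finset.sum_product']
    refine Finset.sum_congr rfl fun x hx => by simp only [hx, if_true]
  simp only [h1]
  refine tendsto_tsum_of_dominated_convergence (summable_five.mul_left C) ?_ ?_
  · intro p
    refine (Pw_tendsto (by omega) (p.1 + p.2)).congr' ?_
    filter_upwards [hT.eventually_ge_atTop p.1, hT.eventually_ge_atTop p.2] with n hn hn2
    rw [if_pos]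
    rw [Finset.mem_product, Finset.mem_range, Finset.mem_range]
    omega
  · filter_upwards [hTB] with n hn p
    split_ifs with hp
    · rw [Real.norm_of_nonneg (Pw_nonneg _ _ _)]
      rw [Finset.mem_product, Finset.mem_range, Finset.mem_range] at hp
      refine (h (n + 1) (p.1 + p.2) 0 ?_).trans ?_
      · have h1 : (p.1:ℝ) ≤ T n := by exact_mod_cast Nat.lt_succ_iff.mp hp.1
        have h2 : (p.2:ℝ) ≤ T n := by exact_mod_cast Nat.lt_succ_iff.mp hp.2
        push_cast at hn ⊢
        linarith
      · gcongr
        exact five_bound _ _ hd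
    · rw [norm_zero]
      positivity

lemma tsum_green_sq (hd : 5 ≤ d) :
    HasSum (fun y => greenZ d y ^ 2) (∑' p : ℕ × ℕ, Pw (eZ d) (p.1 + p.2) 0) := by
  have hd4 : 4 ≤ d := by omega
  obtain ⟨C, hC, h⟩ := Z_decay (d := d) (by omega)
  have hs : Summable (fun p : ℕ × ℕ => Pw (eZ d) (p.1 + p.2) 0) := by
    refine Summable.of_nonneg_of_le (fun t => Pw_nonneg _ _ _) (fun p => ?_) (summable_five.mul_left C)
    refine (h _ _).trans ?_
    gcongr
    exact five_bound _ _ hd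
  have hF : Summable (fun q : (ℕ × ℕ) × (Fin d → ℤ) => Pw (eZ d) q.1.1 q.2 * Pw (eZ d) q.1.2 q.2) := by
    rw [summable_prod_of_nonneg]
    · refine ⟨fun p => (Pw_add (eZ d) p.1 p.2).summable, ?_⟩
      simpa only [(Pw_add (eZ d) _ _).tsum_eq] using hs
    · intro q
      exact mul_nonneg (Pw_nonneg _ _ _) (Pw_nonneg _ _ _)
  have hF2 := hF.prod_symm
  have h1 : ∀ y, ∑' p : ℕ × ℕ, Pw (eZ d) p.1 y * Pw (eZ d) p.2 y = greenZ d y ^ 2 := by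
    intro y
    rw [pow_two, ← (greenZ_hasSum hd4 y).tsum_eq]
    exact (tsum_mul_tsum_of_summable_norm (summable_PwZ hd4 y).norm (summable_PwZ hd4 y).norm).symm
  have h2 : Summable (fun y => greenZ d y ^ 2) := by
    have := hF2.prod
    simpa only [h1, Prod.swap, Prod.fst, Prod.snd] using this
  have h3 : ∑' y, greenZ d y ^ 2 = ∑' p : ℕ × ℕ, Pw (eZ d) (p.1 + p.2) 0 := by
    have := Summable.tsum_comm (f := fun (p : ℕ × ℕ) (y : Fin d → ℤ) =>
      Pw (eZ d) p.1 y * Pw (eZ d) p.2 y) hF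
    simpa only [h1, (Pw_add (eZ d) _ _).tsum_eq] using this
  rw [← h3]
  exact h2.hasSum

lemma T_facts (hd : 0 < d) (c : ℝ) (hc : 1 < c) : ∃ B : ℝ, 0 ≤ B ∧ ∀ᶠ n : ℕ in atTop,
    ((⌊c * (Tmix (torus d (n + 1)) : ℝ)⌋₊ : ℕ) : ℝ) ≤ B * ((n + 1 : ℕ) : ℝ) ^ 2 ∧
    ((n + 1 : ℕ) : ℝ) ^ 2 ≤ 14 * ((⌊c * (Tmix (torus d (n + 1)) : ℝ)⌋₊ : ℕ) : ℝ) := by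
  obtain ⟨C, hC, h⟩ := Tmix_bounds hd
  refine ⟨c * C, by positivity, ?_⟩
  filter_upwards [eventually_ge_atTop 2] with n hn
  obtain ⟨h1, h2⟩ := h (n + 1) (by omega)
  constructor
  · refine (Nat.floor_le (by positivity)).trans ?_
    rw [mul_assoc]
    gcongr
    exact_mod_cast h1
  · refine h2.trans ?_
    gcongr
    apply Nat.le_floor
    have : (0:ℝ) ≤ (Tmix (torus d (n + 1)) : ℝ) := by positivity
    nlinarith

lemma T_atTop (T : ℕ → ℕ) (h : ∀ᶠ n : ℕ in atTop, ((n + 1 : ℕ) : ℝ) ^ 2 ≤ 14 * (T n : ℝ)) :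
    Tendsto T atTop atTop := by
  rw [← tendsto_natCast_atTop_iff (R := ℝ)]
  have h1 : Tendsto (fun n : ℕ => ((n + 1 : ℕ) : ℝ) ^ 2 / 14) atTop atTop := by
    refine Tendsto.atTop_div_const (by norm_num) ?_
    refine (tendsto_pow_atTop (by norm_num)).comp ?_
    exact tendsto_natCast_atTop_atTop.comp (tendsto_add_atTop_nat 1)
  refine tendsto_atTop_mono' _ ?_ h1
  filter_upwards [h] with n hn
  linarith

lemma err_bound (hd : 4 ≤ d) (B : ℝ) (hB : 0 ≤ B) (N : ℕ) (hN : 0 < N) (T : ℝ) (hT : 0 ≤ T)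
    (h : T ≤ B * (N:ℝ) ^ 2) : (2 * T + 1) ^ 2 / (N:ℝ) ^ d ≤ (2 * B + 1) ^ 2 / (N:ℝ) ^ (d - 4) := by
  have hN1 : (1:ℝ) ≤ N := by exact_mod_cast hN
  have h1 : (N:ℝ) ^ d = (N:ℝ) ^ (d - 4) * (N:ℝ) ^ 4 := by rw [← pow_add]; congr 1; omega
  rw [h1, div_le_div_iff₀ (by positivity) (by positivity)]
  have h2 : (2 * T + 1) ^ 2 ≤ ((2 * B + 1) * (N:ℝ) ^ 2) ^ 2 := by
    apply pow_le_pow_left₀ (by positivity)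
    nlinarith
  calc (2 * T + 1) ^ 2 * (N:ℝ) ^ (d - 4) ≤ ((2 * B + 1) * (N:ℝ) ^ 2) ^ 2 * (N:ℝ) ^ (d - 4) := by gcongr
    _ = _ := by ring

lemma main5 (hd : 5 ≤ d) (c : ℝ) (hc : 1 < c) :
    Tendsto (fun n => Fquad (torus d (n + 1)) c / hfun d (n + 1)) atTop (nhds (alphaHigh d)) := by
  have hd4 : 4 ≤ d := by omega
  obtain ⟨B, hB, hT⟩ := T_facts (d := d) (by omega) c hc
  set T : ℕ → ℕ := fun n => ⌊c * (Tmix (torus d (n + 1)) : ℝ)⌋₊ with hTdef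
  have hTtop : Tendsto T atTop atTop := T_atTop T (hT.mono fun n h => h.2)
  have hTB : ∀ᶠ n in atTop, (T n : ℝ) ≤ B * ((n + 1 : ℕ) : ℝ) ^ 2 := hT.mono fun n h => h.1
  have hTT : ∀ᶠ n in atTop, ((T n + T n : ℕ) : ℝ) ≤ (2 * B) * ((n + 1 : ℕ) : ℝ) ^ 2 := by
    filter_upwards [hTB] with n hn
    push_cast at hn ⊢
    linarith
  have hg := gP_tendsto hd4 T hTtop B hB hTB
  have hG := one_le_greenZ hd4
  have hS1 := SP_tendsto5 hd T hTtop B hB hTB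
  have hS2 := SP_tendsto5 hd (fun n => T n + T n)
    (tendsto_atTop_mono (fun n => Nat.le_add_right _ _) hTtop) (2 * B) (by positivity) hTT
  rw [← (tsum_green_sq hd).tsum_eq] at hS1 hS2
  have hG0 : greenZ d 0 ^ 2 ≠ 0 := by positivity
  have hup := hS2.div (hg.pow 2) hG0
  have herr : Tendsto (fun n : ℕ => (2 * B + 1) ^ 2 / ((n + 1 : ℕ) : ℝ) ^ (d - 4)) atTop (nhds 0) := by
    refine Tendsto.const_div_atTop ?_ _
    refine (tendsto_pow_atTop (by omega)).comp ?_
    exact tendsto_natCast_atTop_atTop.comp (tendsto_add_atTop_nat 1)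
  have hlo := (hS1.div (hg.pow 2) hG0).sub herr
  rw [sub_zero] at hlo
  refine tendsto_of_tendsto_of_tendsto_of_le_of_le' hlo hup ?_ ?_
  · filter_upwards [hTB, eventually_ge_atTop 2] with n hn hn2
    have hN : (0:ℝ) < ((n + 1 : ℕ) : ℝ) := by positivity
    have h1 := (Fquad_sandwich (d := d) (by omega) (n + 1) (by omega) c (T n) rfl).1
    have h2 := err_bound hd4 B hB (n + 1) (by omega) (T n) (by positivity) hn
    rw [hfun, if_neg (by omega), if_neg (by omega), le_div_iff₀ (by positivity)]
    refine le_trans ?_ h1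
    simp only [Pi.div_apply, Pi.pow_apply]
    rw [sub_mul]
    rw [div_le_iff₀ (by positivity)] at h2
    have h3 : SP (eT d (n + 1)) (T n) / gP (eT d (n + 1)) (T n) 0 ^ 2 * ((n + 1 : ℕ) : ℝ) ^ d
      = ((n + 1 : ℕ) : ℝ) ^ d * SP (eT d (n + 1)) (T n) / gP (eT d (n + 1)) (T n) 0 ^ 2 := by ring
    rw [h3]
    linarith
  · filter_upwards [eventually_ge_atTop 2] with n hn2
    have h1 := (Fquad_sandwich (d := d) (by omega) (n + 1) (by omega) c (T n) rfl).2
    rw [hfun, if_neg (by omega), if_neg (by omega), div_le_iff₀ (by positivity)]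
    refine h1.trans (le_of_eq ?_)
    simp only [Pi.div_apply, Pi.pow_apply]
    ring

lemma alphaHigh_pos (hd : 5 ≤ d) : 0 < alphaHigh d := by
  have hG := one_le_greenZ (d := d) (by omega)
  have h1 : 0 < ∑' y, greenZ d y ^ 2 :=
    (tsum_green_sq hd).summable.tsum_pos (fun y => by positivity) 0 (by positivity)
  rw [alphaHigh]
  positivity

end limits


section lclt
variable {d : ℕ}

/-- characteristic function -/
def phiZ (θ : Fin d → ℝ) : ℝ := 1 - ∑ i, (1 / (2 * (d : ℝ))) * (1 - Real.cos (θ i))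

/-- real characters -/
def cZ (θ : Fin d → ℝ) (y : Fin d → ℤ) : ℝ := Real.cos (∑ i, θ i * y i)

/-- the box -/
def muBox (d : ℕ) : Measure (Fin d → ℝ) :=
  Measure.pi (fun _ => volume.restrict (Set.Ioc (-Real.pi) Real.pi))

instance : IsFiniteMeasure (muBox d) := by unfold muBox; infer_instance

lemma Mop_cZ (hd : 0 < d) (θ : Fin d → ℝ) : Mop (eZ d) (cZ θ) = phiZ θ • cZ θ := by
  funext y
  rw [Mop_apply]
  have hs : ∀ i, ∑ j, θ j * ((eZ d i j : ℤ) : ℝ) = θ i := by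
    intro i
    rw [Finset.sum_eq_single i]
    · simp [eZ]
    · intro j _ hj
      simp [eZ, Pi.single_eq_of_ne hj]
    · simp
  have : ∀ i, cZ θ (y + eZ d i) + cZ θ (y - eZ d i) = 2 * Real.cos (θ i) * cZ θ y := by
    intro i
    have h1 : ∑ j, θ j * (((y + eZ d i) j : ℤ) : ℝ) = (∑ j, θ j * y j) + θ i := by
      rw [← hs i, ← Finset.sum_add_distrib]
      refine Finset.sum_congr rfl fun j _ => ?_
      simp only [Pi.add_apply]; push_cast; ring
    have h2 : ∑ j, θ j * (((y - eZ d i) j : ℤ) : ℝ) = (∑ j, θ j * y j) - θ i := by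
      rw [← hs i, ← Finset.sum_sub_distrib]
      refine Finset.sum_congr rfl fun j _ => ?_
      simp only [Pi.sub_apply]; push_cast; ring
    rw [cZ, cZ, cZ, h1, h2, Real.cos_add, Real.cos_sub]
    ring
  simp only [this, Pi.smul_apply, smul_eq_mul]
  have hd' : (d:ℝ) ≠ 0 := by positivity
  rw [phiZ, ← Finset.sum_mul, ← Finset.mul_sum, ← Finset.mul_sum, Finset.sum_sub_distrib]
  simp
  field_simp
  ring

lemma Mop_pow_cZ (hd : 0 < d) (θ : Fin d → ℝ) (t : ℕ) :
    (Mop (eZ d) ^ t) (cZ θ) = phiZ θ ^ t • cZ θ := by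
  induction t with
  | zero => simp
  | succ t ih => rw [Mop_pow_succ, ih, map_smul, Mop_cZ hd, smul_smul, pow_succ]

lemma box_exp (n : ℤ) (hn : n ≠ 0) :
    ∫ x in Set.Ioc (-Real.pi) Real.pi, Complex.exp (Complex.I * n * (x:ℂ)) = 0 := by
  have hc : Complex.I * (n:ℂ) ≠ 0 := mul_ne_zero Complex.I_ne_zero (by exact_mod_cast hn)
  rw [← intervalIntegral.integral_of_le (by have := Real.pi_pos; linarith),
    integral_exp_mul_complex hc]
  have : Complex.exp (Complex.I * n * ((Real.pi : ℝ):ℂ)) = Complex.exp (Complex.I * n * ((-Real.pi : ℝ):ℂ)) := by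
    rw [Complex.exp_eq_exp_iff_exists_int]
    refine ⟨n, ?_⟩
    push_cast
    ring
  rw [this, sub_self, zero_div]

lemma cZ_integrable (y : Fin d → ℤ) : Integrable (fun θ => cZ θ y) (muBox d) := by
  refine Integrable.of_bound (C := 1) ?_ ?_
  · apply Continuous.aestronglyMeasurable
    unfold cZ
    fun_prop
  · exact Eventually.of_forall fun θ => Real.abs_cos_le_one _

lemma integral_cZ (y : Fin d → ℤ) (hy : y ≠ 0) : ∫ θ, cZ θ y ∂(muBox d) = 0 := by
  have h1 : ∀ θ : Fin d → ℝ, cZ θ y = Complex.reCLM (∏ i, Complex.exp (Complex.I * (y i) * (θ i : ℂ))) := by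
    intro θ
    rw [← Complex.exp_sum, Complex.reCLM_apply, cZ]
    have : ∑ i, Complex.I * (y i : ℂ) * (θ i : ℂ) = ((∑ i, θ i * y i : ℝ) : ℂ) * Complex.I := by
      push_cast
      rw [Finset.sum_mul]
      refine Finset.sum_congr rfl fun i _ => by ring
    rw [this, Complex.exp_ofReal_mul_I_re]
  simp only [h1]
  have hint : Integrable (fun θ : Fin d → ℝ => ∏ i, Complex.exp (Complex.I * (y i) * (θ i : ℂ))) (muBox d) := by
    refine Integrable.of_bound (C := 1) ?_ ?_
    · apply Continuous.aestronglyMeasurable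
      fun_prop
    · refine Eventually.of_forall fun θ => ?_
      rw [norm_prod]
      apply Finset.prod_le_one (fun _ _ => norm_nonneg _)
      intro i _
      have : Complex.I * (y i : ℂ) * (θ i : ℂ) = ((θ i * y i : ℝ) : ℂ) * Complex.I := by
        push_cast; ring
      rw [this, Complex.norm_exp_ofReal_mul_I]
  rw [Complex.reCLM.integral_comp_comm hint, muBox,
    integral_fintype_prod_eq_prod (fun i (x : ℝ) => Complex.exp (Complex.I * (y i) * (x : ℂ)))]
  obtain ⟨j, hj⟩ := Function.ne_iff.mp hy
  rw [Finset.prod_eq_zero (Finset.mem_univ j) (box_exp (y j) hj)]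
  simp

lemma muBox_univ : (muBox d).real Set.univ = (2 * Real.pi) ^ d := by
  rw [measureReal_def, muBox, Measure.pi_univ]
  simp
  rw [ENNReal.toReal_ofReal (by have := Real.pi_pos; linarith)]
  ring

lemma Pw_integral (hd : 0 < d) (t : ℕ) :
    ∫ θ, phiZ θ ^ t ∂(muBox d) = (2 * Real.pi) ^ d * Pw (eZ d) t 0 := by
  have h1 : ∀ θ : Fin d → ℝ, phiZ θ ^ t = ∑' y, Pw (eZ d) t y * cZ θ y := by
    intro θ
    rw [(hasSum_Pw (eZ d) t (cZ θ)).tsum_eq, Mop_pow_cZ hd]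
    simp [cZ]
  simp only [h1]
  have hpi : 0 < (2 * Real.pi) ^ d := by have := Real.pi_pos; positivity
  have h2 := hasSum_integral_of_summable_integral_norm (μ := muBox d)
    (F := fun (y : Fin d → ℤ) θ => Pw (eZ d) t y * cZ θ y) (fun y => (cZ_integrable y).const_mul _) ?_
  · rw [← h2.tsum_eq, tsum_eq_single 0]
    · simp only [integral_const_mul]
      have : ∀ θ : Fin d → ℝ, cZ θ 0 = 1 := by simp [cZ]
      simp only [this]
      rw [integral_const, muBox_univ]
      simp [mul_comm]
    · intro y hy
      rw [integral_const_mul, integral_cZ y hy, mul_zero]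
  · refine Summable.of_nonneg_of_le (fun y => integral_nonneg fun _ => norm_nonneg _) (fun y => ?_)
      ((Pw_sum_one hd (eZ d) t).summable.mul_left ((2 * Real.pi) ^ d))
    calc ∫ θ, ‖Pw (eZ d) t y * cZ θ y‖ ∂(muBox d) ≤ ∫ θ, Pw (eZ d) t y ∂(muBox d) := by
          refine integral_mono ((cZ_integrable y).const_mul _).norm (integrable_const _) fun θ => ?_
          show ‖Pw (eZ d) t y * cZ θ y‖ ≤ Pw (eZ d) t y
          rw [norm_mul, Real.norm_of_nonneg (Pw_nonneg _ _ _)]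
          exact mul_le_of_le_one_right (Pw_nonneg _ _ _) (Real.abs_cos_le_one _)
      _ = _ := by
          rw [integral_const, muBox_univ, smul_eq_mul]

end lclt


section lclt2
variable {d : ℕ}

lemma phiZ_nonneg (hd : 0 < d) (θ : Fin d → ℝ) : 0 ≤ phiZ θ := by
  have hd' : (d:ℝ) ≠ 0 := by positivity
  rw [phiZ, sub_nonneg]
  calc ∑ i, (1 / (2 * (d : ℝ))) * (1 - Real.cos (θ i)) ≤ ∑ i : Fin d, (1 / (2 * (d : ℝ))) * 2 := by
        gcongr with i _
        have := Real.neg_one_le_cos (θ i)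
        linarith
    _ = 1 := by
        simp
        field_simp

lemma phiZ_le (θ : Fin d → ℝ) (h : ∀ i, |θ i| ≤ Real.pi) :
    phiZ θ ≤ Real.exp (-∑ i, (1 / (d * Real.pi ^ 2)) * θ i ^ 2) := by
  have h1 : ∑ i, (1 / (d * Real.pi ^ 2)) * θ i ^ 2 ≤ ∑ i, (1 / (2 * (d : ℝ))) * (1 - Real.cos (θ i)) := by
    apply Finset.sum_le_sum
    intro i _
    have := Real.cos_le_one_sub_mul_cos_sq (h i)
    have h2 : (1 / (d * Real.pi ^ 2)) * θ i ^ 2 = (1 / (2 * (d : ℝ))) * (2 / Real.pi ^ 2 * θ i ^ 2) := by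
      have := Real.pi_pos
      field_simp
    rw [h2]
    gcongr
    linarith
  have := Real.add_one_le_exp (-∑ i, (1 / (d * Real.pi ^ 2)) * θ i ^ 2)
  rw [phiZ]
  linarith

/-- the box as a set -/
def bx (d : ℕ) : Set (Fin d → ℝ) := Set.univ.pi fun _ => Set.Ioc (-Real.pi) Real.pi

lemma muBox_eq : muBox d = (volume : Measure (Fin d → ℝ)).restrict (bx d) := by
  rw [volume_pi, bx, Measure.restrict_pi_pi]
  rfl

lemma bx_meas : MeasurableSet (bx d) :=
  MeasurableSet.univ_pi fun _ => measurableSet_Ioc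

lemma scaled_integral (hd : 0 < d) (t : ℕ) (ht : 0 < t) :
    ∫ u : Fin d → ℝ, (bx d).indicator (fun θ => phiZ θ ^ t) ((√(t:ℝ))⁻¹ • u)
      = (√(t:ℝ)) ^ d * ((2 * Real.pi) ^ d * Pw (eZ d) t 0) := by
  rw [Measure.integral_comp_smul, integral_indicator bx_meas, ← muBox_eq, Pw_integral hd]
  have : (0:ℝ) < √(t:ℝ) := Real.sqrt_pos.mpr (by exact_mod_cast ht)
  rw [Module.finrank_fintype_fun_eq_card, Fintype.card_fin, inv_pow, inv_inv, abs_of_pos (by positivity),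
    smul_eq_mul]

lemma cos_lim (u : ℝ) : Tendsto (fun t : ℕ => (t:ℝ) * (1 - Real.cos ((√(t:ℝ))⁻¹ * u))) atTop
    (nhds (u ^ 2 / 2)) := by
  rw [tendsto_iff_norm_sub_tendsto_zero]
  have h0 : Tendsto (fun t : ℕ => (u ^ 4 * (5 / 96)) / (t:ℝ)) atTop (nhds 0) :=
    Tendsto.const_div_atTop tendsto_natCast_atTop_atTop _
  have h1 : Tendsto (fun t : ℕ => (√(t:ℝ))⁻¹ * u) atTop (nhds (0 * u)) := by
    refine Tendsto.mul_const _ (tendsto_inv_atTop_zero.comp ?_)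
    exact Real.tendsto_sqrt_atTop.comp tendsto_natCast_atTop_atTop
  rw [zero_mul] at h1
  have h2 : ∀ᶠ t : ℕ in atTop, |(√(t:ℝ))⁻¹ * u| ≤ 1 := by
    have := h1.abs
    rw [abs_zero] at this
    exact this.eventually_le_const (by norm_num)
  refine squeeze_zero' (Eventually.of_forall fun _ => norm_nonneg _) ?_ h0
  filter_upwards [h2, eventually_gt_atTop 0] with t ht ht0
  have htp : (0:ℝ) < t := by exact_mod_cast ht0
  have hb := Real.cos_bound ht
  have hs : ((√(t:ℝ))⁻¹ * u) ^ 2 = u ^ 2 / t := by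
    rw [mul_pow, inv_pow, Real.sq_sqrt htp.le]; field_simp
  have hs4 : |(√(t:ℝ))⁻¹ * u| ^ 4 = u ^ 4 / t ^ 2 := by
    rw [show (4:ℕ) = 2 * 2 from rfl, pow_mul, sq_abs, hs]; ring
  rw [hs, hs4] at hb
  have h3 : (t:ℝ) * (1 - Real.cos ((√(t:ℝ))⁻¹ * u)) - u ^ 2 / 2
      = - (t * (Real.cos ((√(t:ℝ))⁻¹ * u) - (1 - u ^ 2 / t / 2))) := by
    field_simp
    ring
  rw [h3, norm_neg, norm_mul, Real.norm_of_nonneg htp.le, Real.norm_eq_abs]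
  calc t * |Real.cos ((√(t:ℝ))⁻¹ * u) - (1 - u ^ 2 / t / 2)| ≤ t * (u ^ 4 / t ^ 2 * (5 / 96)) := by gcongr
    _ = _ := by field_simp

lemma phiZ_lim (u : Fin d → ℝ) : Tendsto (fun t : ℕ => phiZ ((√(t:ℝ))⁻¹ • u) ^ t) atTop
    (nhds (Real.exp (-∑ i, (1 / (4 * d)) * u i ^ 2))) := by
  have : ∀ t : ℕ, phiZ ((√(t:ℝ))⁻¹ • u)
      = 1 + (-∑ i, (1 / (2 * (d : ℝ))) * (1 - Real.cos ((√(t:ℝ))⁻¹ * u i))) := by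
    intro t
    rw [phiZ, sub_eq_add_neg]
    simp
  simp only [this]
  apply Real.tendsto_one_add_pow_exp_of_tendsto
  have h1 : Tendsto (fun t : ℕ => -∑ i, (1 / (2 * (d : ℝ))) * ((t:ℝ) * (1 - Real.cos ((√(t:ℝ))⁻¹ * u i)))) atTop
      (nhds (-∑ i, (1 / (2 * (d : ℝ))) * (u i ^ 2 / 2))) :=
    (tendsto_finset_sum _ fun i _ => (cos_lim (u i)).const_mul _).neg
  convert h1 using 2
  · rw [mul_neg, Finset.mul_sum]
    congr 1
    refine Finset.sum_congr rfl fun i _ => by ring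
  · congr 1
    refine Finset.sum_congr rfl fun i _ => by ring

lemma gauss_prod (b : ℝ) (u : Fin d → ℝ) :
    Real.exp (-∑ i, b * u i ^ 2) = ∏ i, Real.exp (-b * u i ^ 2) := by
  rw [← Real.exp_sum, ← Finset.sum_neg_distrib]
  simp only [neg_mul]

lemma lclt_gen (hd : 0 < d) : ∃ C : ℝ, 0 < C ∧
    Tendsto (fun t : ℕ => (√(t:ℝ)) ^ d * Pw (eZ d) t 0) atTop (nhds C) := by
  have hpi := Real.pi_pos
  have hdR : (0:ℝ) < d := by exact_mod_cast hd
  have hlim : Tendsto (fun t : ℕ => ∫ u : Fin d → ℝ,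
      (bx d).indicator (fun θ => phiZ θ ^ t) ((√(t:ℝ))⁻¹ • u)) atTop
      (nhds (∫ u : Fin d → ℝ, Real.exp (-∑ i, (1 / (4 * d)) * u i ^ 2))) := by
    refine tendsto_integral_filter_of_dominated_convergence
      (fun u : Fin d → ℝ => Real.exp (-∑ i, (1 / (d * Real.pi ^ 2)) * u i ^ 2)) ?_ ?_ ?_ ?_
    · refine Eventually.of_forall fun t => ?_
      apply Measurable.aestronglyMeasurable
      refine Measurable.comp (g := (bx d).indicator (fun θ => phiZ θ ^ t)) ?_ (by fun_prop)
      refine Measurable.indicator ?_ bx_meas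
      unfold phiZ
      fun_prop
    · filter_upwards [eventually_gt_atTop 0] with t ht
      have htp : (0:ℝ) < t := by exact_mod_cast ht
      refine Eventually.of_forall fun u => ?_
      by_cases hu : (√(t:ℝ))⁻¹ • u ∈ bx d
      · rw [Set.indicator_of_mem hu, Real.norm_of_nonneg (pow_nonneg (phiZ_nonneg hd _) _)]
        have h1 := phiZ_le ((√(t:ℝ))⁻¹ • u) (fun i => by
          have := hu i (Set.mem_univ i)
          rw [abs_le]
          exact ⟨this.1.le, this.2⟩)
        refine (pow_le_pow_left₀ (phiZ_nonneg hd _) h1 t).trans (le_of_eq ?_)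
        rw [← Real.exp_nat_mul, mul_neg, Finset.mul_sum]
        congr 2
        refine Finset.sum_congr rfl fun i _ => ?_
        simp only [Pi.smul_apply, smul_eq_mul]
        rw [mul_pow, inv_pow, Real.sq_sqrt htp.le]
        field_simp
      · rw [Set.indicator_of_notMem hu, norm_zero]
        positivity
    · simp only [gauss_prod]
      exact Integrable.fintype_prod (f := fun (_ : Fin d) (x : ℝ) => Real.exp (-(1 / (d * Real.pi ^ 2)) * x ^ 2))
        (fun i => integrable_exp_neg_mul_sq (by positivity))
    · refine Eventually.of_forall fun u => ?_
      refine (phiZ_lim u).congr' ?_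
      have h1 : ∀ i, Tendsto (fun t : ℕ => (√(t:ℝ))⁻¹ * u i) atTop (nhds (0 * u i)) := by
        intro i
        refine Tendsto.mul_const _ (tendsto_inv_atTop_zero.comp ?_)
        exact Real.tendsto_sqrt_atTop.comp tendsto_natCast_atTop_atTop
      have h2 : ∀ᶠ t : ℕ in atTop, ∀ i, (√(t:ℝ))⁻¹ * u i ∈ Set.Ioo (-Real.pi) Real.pi := by
        rw [eventually_all]
        intro i
        refine (h1 i).eventually (Ioo_mem_nhds ?_ ?_) <;> rw [zero_mul] <;> linarith
      filter_upwards [h2] with t ht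
      rw [Set.indicator_of_mem]
      intro i _
      exact ⟨(ht i).1, (ht i).2.le⟩
  refine ⟨((2 * Real.pi) ^ d)⁻¹ * ∫ u : Fin d → ℝ, Real.exp (-∑ i, (1 / (4 * d)) * u i ^ 2), ?_, ?_⟩
  · apply mul_pos (by positivity)
    simp only [gauss_prod]
    rw [integral_fintype_prod_volume_eq_prod (fun (_ : Fin d) (x : ℝ) => Real.exp (-(1 / (4 * d)) * x ^ 2))]
    simp only [integral_gaussian]
    apply Finset.prod_pos
    intro i _
    apply Real.sqrt_pos.mpr
    positivity
  · refine (hlim.const_mul ((2 * Real.pi) ^ d)⁻¹).congr' ?_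
    filter_upwards [eventually_gt_atTop 0] with t ht
    rw [scaled_integral hd t ht]
    field_simp

lemma lclt4 : ∃ C : ℝ, 0 < C ∧
    Tendsto (fun t : ℕ => ((t:ℝ) + 1) ^ 2 * Pw (eZ 4) t 0) atTop (nhds C) := by
  obtain ⟨C, hC, h⟩ := lclt_gen (d := 4) (by norm_num)
  refine ⟨C, hC, ?_⟩
  have h1 : Tendsto (fun t : ℕ => (1 + 1 / (t:ℝ)) ^ 2) atTop (nhds ((1 + 0) ^ 2)) :=
    (tendsto_one_div_atTop_nhds_zero_nat.const_add 1).pow 2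
  have h2 := h1.mul h
  rw [add_zero, one_pow, one_mul] at h2
  refine h2.congr' ?_
  filter_upwards [eventually_gt_atTop 0] with t ht
  have htp : (0:ℝ) < t := by exact_mod_cast ht
  rw [show (4:ℕ) = 2 * 2 from rfl, pow_mul, Real.sq_sqrt htp.le]
  field_simp

end lclt2


section tri

/-- weighted sums -/
def tri (a : ℕ → ℝ) (n : ℕ) : ℝ := ∑ k ∈ Finset.range n, ((k:ℝ) + 1) * a k

/-- double sums -/
def dbl (a : ℕ → ℝ) (T : ℕ) : ℝ :=
  ∑ s ∈ Finset.range (T + 1), ∑ t ∈ Finset.range (T + 1), a (s + t)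

lemma dbl_eq (a : ℕ → ℝ) (T : ℕ) : dbl a T = ∑ k ∈ Finset.range (2 * T + 1),
    (((Finset.range (T + 1) ×ˢ Finset.range (T + 1)).filter (fun p => p.1 + p.2 = k)).card : ℝ) * a k := by
  rw [dbl, ← Finset.sum_product', ← Finset.sum_fiberwise_of_maps_to (t := Finset.range (2 * T + 1))
    (g := fun p : ℕ × ℕ => p.1 + p.2)]
  · refine Finset.sum_congr rfl fun k _ => ?_
    rw [Finset.sum_congr rfl (g := fun _ => a k), Finset.sum_const, nsmul_eq_mul]
    intro p hp
    rw [(Finset.mem_filter.mp hp).2]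
  · intro p hp
    rw [Finset.mem_product, Finset.mem_range, Finset.mem_range] at hp
    rw [Finset.mem_range]
    omega

lemma dbl_le (a : ℕ → ℝ) (ha : ∀ k, 0 ≤ a k) (T : ℕ) : dbl a T ≤ tri a (2 * T + 1) := by
  rw [dbl_eq, tri]
  refine Finset.sum_le_sum fun k _ => mul_le_mul_of_nonneg_right ?_ (ha k)
  have : ((Finset.range (T + 1) ×ˢ Finset.range (T + 1)).filter (fun p => p.1 + p.2 = k)).card
      ≤ (Finset.HasAntidiagonal.antidiagonal k).card := by
    apply Finset.card_le_card
    intro p hp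
    exact Finset.HasAntidiagonal.mem_antidiagonal.mpr (Finset.mem_filter.mp hp).2
  rw [Finset.Nat.card_antidiagonal] at this
  exact_mod_cast this

lemma le_dbl (a : ℕ → ℝ) (ha : ∀ k, 0 ≤ a k) (T : ℕ) : tri a (T + 1) ≤ dbl a T := by
  rw [dbl_eq, tri]
  refine le_trans ?_ (Finset.sum_le_sum_of_subset_of_nonneg
    (Finset.range_mono (by omega : T + 1 ≤ 2 * T + 1)) fun k _ _ => mul_nonneg (by positivity) (ha k))
  refine Finset.sum_le_sum fun k hk => mul_le_mul_of_nonneg_right ?_ (ha k)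
  have : (Finset.HasAntidiagonal.antidiagonal k).card ≤
      ((Finset.range (T + 1) ×ˢ Finset.range (T + 1)).filter (fun p => p.1 + p.2 = k)).card := by
    apply Finset.card_le_card
    intro p hp
    rw [Finset.HasAntidiagonal.mem_antidiagonal] at hp
    rw [Finset.mem_range] at hk
    rw [Finset.mem_filter, Finset.mem_product, Finset.mem_range, Finset.mem_range]
    refine ⟨⟨?_, ?_⟩, hp⟩ <;> omega
  rw [Finset.Nat.card_antidiagonal] at this
  exact_mod_cast this

lemma harm_log : Tendsto (fun n : ℕ => (∑ k ∈ Finset.range n, 1 / ((k:ℝ) + 1)) / Real.log n) atTop (nhds 1) := by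
  have hl : Tendsto (fun n : ℕ => Real.log n) atTop atTop :=
    Real.tendsto_log_atTop.comp tendsto_natCast_atTop_atTop
  have h := Real.tendsto_harmonic_sub_log
  have h1 := (h.div_atTop hl).add_const 1
  rw [zero_add] at h1
  refine h1.congr' ?_
  filter_upwards [hl.eventually_gt_atTop 0] with n hn
  have : ((harmonic n : ℚ) : ℝ) = ∑ k ∈ Finset.range n, 1 / ((k:ℝ) + 1) := by
    simp [harmonic]
  rw [this]
  field_simp
  ring

lemma tri_lim (a : ℕ → ℝ) (C : ℝ) (h : Tendsto (fun k : ℕ => ((k:ℝ) + 1) ^ 2 * a k) atTop (nhds C)) :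
    Tendsto (fun n : ℕ => tri a n / Real.log n) atTop (nhds C) := by
  have hl : Tendsto (fun n : ℕ => Real.log n) atTop atTop :=
    Real.tendsto_log_atTop.comp tendsto_natCast_atTop_atTop
  have hH : Tendsto (fun n : ℕ => ∑ k ∈ Finset.range n, 1 / ((k:ℝ) + 1)) atTop atTop := by
    have := harm_log.pos_mul_atTop one_pos hl
    refine this.congr' ?_
    filter_upwards [hl.eventually_gt_atTop 0] with n hn
    field_simp
  have ho : (fun k : ℕ => ((k:ℝ) + 1) * a k - C * (1 / ((k:ℝ) + 1))) =o[atTop] (fun k : ℕ => 1 / ((k:ℝ) + 1)) := by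
    rw [Asymptotics.isLittleO_iff_tendsto (fun k hk => by
      exfalso
      have : (0:ℝ) < 1 / ((k:ℝ) + 1) := by positivity
      linarith)]
    have := h.sub_const C
    rw [sub_self] at this
    refine this.congr fun k => ?_
    have : ((k:ℝ) + 1) ≠ 0 := by positivity
    field_simp
  have ho2 := ho.sum_range (fun k => by positivity) hH
  have h3 := ho2.tendsto_div_nhds_zero
  have h4 := (h3.add_const C).mul harm_log
  rw [zero_add, mul_one] at h4
  refine h4.congr' ?_
  filter_upwards [hl.eventually_gt_atTop 0, hH.eventually_gt_atTop 0] with n hn hn2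
  rw [Finset.sum_sub_distrib, ← Finset.mul_sum, tri]
  field_simp
  ring

lemma log_ratio (X N : ℕ → ℕ) (a b : ℝ) (ha : 0 < a) (hN : Tendsto N atTop atTop)
    (h1 : ∀ᶠ n in atTop, a * (N n : ℝ) ^ 2 ≤ X n) (h2 : ∀ᶠ n in atTop, (X n : ℝ) ≤ b * (N n : ℝ) ^ 2) :
    Tendsto (fun n => Real.log (X n) / Real.log (N n)) atTop (nhds 2) := by
  have hl : Tendsto (fun n : ℕ => Real.log (N n)) atTop atTop :=
    Real.tendsto_log_atTop.comp (tendsto_natCast_atTop_atTop.comp hN)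
  have hlo := ((tendsto_const_nhds (x := Real.log a)).div_atTop hl).add_const 2
  have hup := ((tendsto_const_nhds (x := Real.log b)).div_atTop hl).add_const 2
  rw [zero_add] at hlo hup
  refine tendsto_of_tendsto_of_tendsto_of_le_of_le' hlo hup ?_ ?_
  · filter_upwards [h1, hl.eventually_gt_atTop 0, hN.eventually_gt_atTop 0] with n hn hn1 hn2
    have hNp : (0:ℝ) < N n := by exact_mod_cast hn2
    have := Real.log_le_log (by positivity) hn
    rw [Real.log_mul (by positivity) (by positivity), Real.log_pow] at this
    rw [le_div_iff₀ hn1, add_mul, div_mul_cancel₀ _ hn1.ne']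
    exact_mod_cast this
  · filter_upwards [h1, h2, hl.eventually_gt_atTop 0, hN.eventually_gt_atTop 0] with n hn0 hn hn1 hn2
    have hNp : (0:ℝ) < N n := by exact_mod_cast hn2
    have hX : (0:ℝ) < X n := lt_of_lt_of_le (by positivity) hn0
    have hb : 0 < b := by
      by_contra hb
      have : b * (N n : ℝ) ^ 2 ≤ 0 := mul_nonpos_of_nonpos_of_nonneg (by linarith) (by positivity)
      linarith
    have := Real.log_le_log hX hn
    rw [Real.log_mul (by positivity) (by positivity), Real.log_pow] at this
    rw [div_le_iff₀ hn1, add_mul, div_mul_cancel₀ _ hn1.ne']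
    exact_mod_cast this

lemma tri_ratio (a : ℕ → ℝ) (C : ℝ) (h : Tendsto (fun k : ℕ => ((k:ℝ) + 1) ^ 2 * a k) atTop (nhds C))
    (X N : ℕ → ℕ) (α β : ℝ) (hα : 0 < α) (hN : Tendsto N atTop atTop)
    (h1 : ∀ᶠ n in atTop, α * (N n : ℝ) ^ 2 ≤ X n) (h2 : ∀ᶠ n in atTop, (X n : ℝ) ≤ β * (N n : ℝ) ^ 2) :
    Tendsto (fun n => tri a (X n) / Real.log (N n)) atTop (nhds (2 * C)) := by
  have hX : Tendsto X atTop atTop := by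
    rw [← tendsto_natCast_atTop_iff (R := ℝ)]
    refine tendsto_atTop_mono' _ h1 ?_
    refine Tendsto.const_mul_atTop hα ((tendsto_pow_atTop (by norm_num)).comp ?_)
    exact tendsto_natCast_atTop_atTop.comp hN
  have h3 := ((tri_lim a C h).comp hX).mul (log_ratio X N α β hα hN h1 h2)
  rw [mul_comm] at h3
  refine h3.congr' ?_
  have hl : Tendsto (fun n : ℕ => Real.log (X n)) atTop atTop :=
    Real.tendsto_log_atTop.comp (tendsto_natCast_atTop_atTop.comp hX)
  filter_upwards [hl.eventually_gt_atTop 0] with n hn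
  simp only [Function.comp]
  field_simp

end tri


section four

/-- return probabilities in dimension four -/
def a4 (k : ℕ) : ℝ := Pw (eZ 4) k 0

lemma a4_nonneg (k : ℕ) : 0 ≤ a4 k := Pw_nonneg _ _ _

lemma half_arith (C M : ℝ) (hC : 0 ≤ C) (hM : 0 < M) (k s t : ℕ) (hs : s = k / 2) (ht : t = k - s) :
    (s * (C / ((t:ℝ) + 1) ^ 2) + t * (C / ((s:ℝ) + 1) ^ 2)) / M ≤ 4 * C / (((k:ℝ) + 1) * M) := by
  have h1 : (s:ℝ) ≤ t := by exact_mod_cast (by omega : s ≤ t)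
  have h2 : (t:ℝ) ≤ s + 1 := by exact_mod_cast (by omega : t ≤ s + 1)
  have h3 : (k:ℝ) = s + t := by exact_mod_cast (by omega : k = s + t)
  have hs0 : (0:ℝ) ≤ s := by positivity
  have e1 : (s:ℝ) * (C / ((t:ℝ) + 1) ^ 2) ≤ 2 * C / ((k:ℝ) + 1) := by
    rw [← mul_div_assoc, div_le_div_iff₀ (by positivity) (by positivity), h3]
    have : (s:ℝ) * (s + t + 1) ≤ 2 * ((t:ℝ) + 1) ^ 2 := by nlinarith
    nlinarith
  have e2 : (t:ℝ) * (C / ((s:ℝ) + 1) ^ 2) ≤ 2 * C / ((k:ℝ) + 1) := by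
    rw [← mul_div_assoc, div_le_div_iff₀ (by positivity) (by positivity), h3]
    have : (t:ℝ) * (s + t + 1) ≤ 2 * ((s:ℝ) + 1) ^ 2 := by nlinarith
    nlinarith
  calc _ ≤ (2 * C / ((k:ℝ) + 1) + 2 * C / ((k:ℝ) + 1)) / M := by gcongr
    _ = _ := by
      rw [← div_div]
      ring

lemma torus_tri (B : ℝ) (hB : 0 ≤ B) : ∃ D : ℝ, 0 ≤ D ∧ ∀ (N : ℕ) [NeZero N] (T : ℕ),
    (T:ℝ) ≤ B * (N:ℝ) ^ 2 → SP (eT 4 N) T ≤ tri a4 (2 * T + 1) + D := by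
  obtain ⟨C, hC, h⟩ := torus_decay4 (d := 4) le_rfl (2 * B) (by positivity)
  refine ⟨4 * C * (2 * B + 1), by positivity, fun N _ T hT => ?_⟩
  have hNp : 0 < N := Nat.pos_of_ne_zero (NeZero.ne N)
  have hN1 : (1:ℝ) ≤ N := by exact_mod_cast hNp
  have h1 : SP (eT 4 N) T ≤ tri (fun k => Pw (eT 4 N) k 0) (2 * T + 1) :=
    dbl_le (fun k => Pw (eT 4 N) k 0) (fun k => Pw_nonneg _ _ _) T
  refine h1.trans ?_
  rw [← sub_le_iff_le_add', tri, tri, ← Finset.sum_sub_distrib]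
  calc _ ≤ ∑ k ∈ Finset.range (2 * T + 1), 4 * C / (N:ℝ) ^ 2 := by
        refine Finset.sum_le_sum fun k hk => ?_
        rw [Finset.mem_range] at hk
        rw [← mul_sub]
        have hkT : (k:ℝ) ≤ 2 * T := by exact_mod_cast (by omega : k ≤ 2 * T)
        have hle : ∀ s : ℕ, s ≤ k → (s:ℝ) ≤ 2 * B * (N:ℝ) ^ 2 := by
          intro s hs
          have : (s:ℝ) ≤ k := by exact_mod_cast hs
          linarith
        have h2 := diff_half (d := 4) (by norm_num) N (k / 2) (k - k / 2) hNp _ _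
          (fun y => h N (k / 2) y (hle _ (by omega))) (fun y => h N (k - k / 2) y (hle _ (by omega)))
        rw [show k / 2 + (k - k / 2) = k by omega] at h2
        have h3 := h2.trans (half_arith C ((N:ℝ) ^ 2) hC.le (by positivity) k (k / 2) (k - k / 2) rfl rfl)
        calc ((k:ℝ) + 1) * (Pw (eT 4 N) k 0 - a4 k) ≤ ((k:ℝ) + 1) * (4 * C / (((k:ℝ) + 1) * (N:ℝ) ^ 2)) := by
              gcongr
              exact h3
          _ = _ := by field_simp
    _ = (2 * T + 1) * (4 * C / (N:ℝ) ^ 2) := by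
        rw [Finset.sum_const, Finset.card_range, nsmul_eq_mul]
        push_cast
        ring
    _ ≤ ((2 * B + 1) * (N:ℝ) ^ 2) * (4 * C / (N:ℝ) ^ 2) := by
        gcongr
        nlinarith
    _ = _ := by field_simp

lemma torus_tri_low (N T : ℕ) : tri a4 (T + 1) ≤ SP (eT 4 N) T := by
  refine (le_dbl a4 a4_nonneg T).trans ?_
  exact Finset.sum_le_sum fun s _ => Finset.sum_le_sum fun t _ => Pw_Z_le_T _ _

lemma main4 (C₀ : ℝ) (hlc : Tendsto (fun t : ℕ => ((t:ℝ) + 1) ^ 2 * a4 t) atTop (nhds C₀))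
    (c : ℝ) (hc : 1 < c) :
    Tendsto (fun n => Fquad (torus 4 (n + 1)) c / hfun 4 (n + 1)) atTop
      (nhds (2 * C₀ / greenZ 4 0 ^ 2)) := by
  obtain ⟨B, hB, hT⟩ := T_facts (d := 4) (by omega) c hc
  set T : ℕ → ℕ := fun n => ⌊c * (Tmix (torus 4 (n + 1)) : ℝ)⌋₊ with hTdef
  have hTtop : Tendsto T atTop atTop := T_atTop T (hT.mono fun n h => h.2)
  have hTB : ∀ᶠ n in atTop, (T n : ℝ) ≤ B * ((n + 1 : ℕ) : ℝ) ^ 2 := hT.mono fun n h => h.1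
  have hTL : ∀ᶠ n in atTop, ((n + 1 : ℕ) : ℝ) ^ 2 ≤ 14 * (T n : ℝ) := hT.mono fun n h => h.2
  have hg := gP_tendsto (d := 4) le_rfl T hTtop B hB hTB
  have hG := one_le_greenZ (d := 4) le_rfl
  have hG0 : greenZ 4 0 ^ 2 ≠ 0 := by positivity
  obtain ⟨D, hD, hDS⟩ := torus_tri (2 * B) (by positivity)
  have hN : Tendsto (fun n : ℕ => n + 1) atTop atTop := tendsto_add_atTop_nat 1
  have hl : Tendsto (fun n : ℕ => Real.log ((n + 1 : ℕ) : ℝ)) atTop atTop :=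
    Real.tendsto_log_atTop.comp (tendsto_natCast_atTop_atTop.comp hN)
  have hN1 : ∀ n : ℕ, (1:ℝ) ≤ ((n + 1 : ℕ) : ℝ) ^ 2 := by
    intro n
    apply one_le_pow₀
    exact_mod_cast Nat.succ_le_succ (Nat.zero_le n)
  have hlow := tri_ratio a4 C₀ hlc (fun n => T n + 1) (fun n => n + 1) (1 / 14) (B + 1) (by norm_num) hN
    (by
      filter_upwards [hTL] with n hn
      push_cast at hn ⊢
      linarith)
    (by
      filter_upwards [hTB] with n hn
      have := hN1 n
      push_cast at hn this ⊢
      linarith)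
  have hup := tri_ratio a4 C₀ hlc (fun n => 2 * (T n + T n) + 1) (fun n => n + 1) (1 / 14) (4 * B + 1)
    (by norm_num) hN
    (by
      filter_upwards [hTL] with n hn
      push_cast at hn ⊢
      have : (0:ℝ) ≤ T n := by positivity
      linarith)
    (by
      filter_upwards [hTB] with n hn
      have := hN1 n
      push_cast at hn this ⊢
      linarith)
  have hdl := (tendsto_const_nhds (x := D)).div_atTop hl
  have hel := (tendsto_const_nhds (x := (2 * B + 1) ^ 2)).div_atTop hl
  have hUP := (hup.add hdl).div (hg.pow 2) hG0
  have hLO := (hlow.div (hg.pow 2) hG0).sub hel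
  rw [add_zero] at hUP
  rw [sub_zero] at hLO
  refine tendsto_of_tendsto_of_tendsto_of_le_of_le' hLO hUP ?_ ?_
  · filter_upwards [hTB, eventually_ge_atTop 2, hl.eventually_gt_atTop 0] with n hn hn2 hlog
    have hNp : (0:ℝ) < ((n + 1 : ℕ) : ℝ) := by positivity
    have h1 := (Fquad_sandwich (d := 4) (by omega) (n + 1) (by omega) c (T n) rfl).1
    have h2 := err_bound (d := 4) le_rfl B hB (n + 1) (by omega) (T n) (by positivity) hn
    have h3 := torus_tri_low (n + 1) (T n)
    have hgp := one_le_gP (eT 4 (n + 1)) (T n)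
    rw [hfun, if_neg (by omega), if_pos rfl, le_div_iff₀ (by positivity)]
    refine le_trans ?_ h1
    simp only [Pi.div_apply, Pi.pow_apply]
    simp only [Nat.sub_self, pow_zero, div_one] at h2
    rw [div_le_iff₀ (by positivity)] at h2
    rw [sub_mul]
    apply sub_le_sub
    · calc tri a4 (T n + 1) / Real.log ((n + 1 : ℕ) : ℝ) / gP (eT 4 (n + 1)) (T n) 0 ^ 2
            * (((n + 1 : ℕ) : ℝ) ^ 4 * Real.log ((n + 1 : ℕ) : ℝ))
          = ((n + 1 : ℕ) : ℝ) ^ 4 * tri a4 (T n + 1) / gP (eT 4 (n + 1)) (T n) 0 ^ 2 := by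
            field_simp
        _ ≤ _ := by gcongr
    · refine h2.trans (le_of_eq ?_)
      field_simp
  · filter_upwards [hTB, eventually_ge_atTop 2, hl.eventually_gt_atTop 0] with n hn hn2 hlog
    have h1 := (Fquad_sandwich (d := 4) (by omega) (n + 1) (by omega) c (T n) rfl).2
    have h3 := hDS (n + 1) (T n + T n) (by push_cast at hn ⊢; linarith)
    have hgp := one_le_gP (eT 4 (n + 1)) (T n)
    rw [hfun, if_neg (by omega), if_pos rfl, div_le_iff₀ (by positivity)]
    refine h1.trans ?_
    simp only [Pi.div_apply, Pi.pow_apply]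
    calc _ ≤ ((n + 1 : ℕ) : ℝ) ^ 4 * (tri a4 (2 * (T n + T n) + 1) + D) / gP (eT 4 (n + 1)) (T n) 0 ^ 2 := by
          gcongr
      _ = _ := by field_simp

end four


section lattice

lemma green_tail : ∃ C : ℝ, 0 < C ∧ ∀ (T : ℕ) (y : Fin 4 → ℤ),
    greenZ 4 y ≤ gP (eZ 4) T y + C / ((T:ℝ) + 1) := by
  obtain ⟨C, hC, h⟩ := Z_decay4 (d := 4) le_rfl
  refine ⟨C, hC, fun T y => ?_⟩
  have key : ∀ k : ℕ, ∑ t ∈ Finset.range (T + 1 + k), Pw (eZ 4) t y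
      ≤ gP (eZ 4) T y + (C / ((T:ℝ) + 1) - C / ((T:ℝ) + 1 + k)) := by
    intro k
    induction k with
    | zero => simp [gP]
    | succ k ih =>
      rw [← Nat.add_assoc, Finset.sum_range_succ]
      have h1 := h (T + 1 + k) y
      have h2 : C / (((T + 1 + k : ℕ):ℝ) + 1) ^ 2 ≤ C / ((T:ℝ) + 1 + k) - C / ((T:ℝ) + 1 + (k + 1 : ℕ)) := by
        push_cast
        have hx : (0:ℝ) < (T:ℝ) + 1 + k := by positivity
        have : C / ((T:ℝ) + 1 + k) - C / ((T:ℝ) + 1 + (k + 1))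
            = C / (((T:ℝ) + 1 + k) * ((T:ℝ) + 1 + k + 1)) := by
          field_simp
          ring
        rw [this]
        gcongr
        nlinarith
      linarith
  have ht := ((greenZ_hasSum (d := 4) le_rfl y).tendsto_sum_nat).comp
    (tendsto_add_atTop_nat (T + 1))
  refine le_of_tendsto' ht fun k => ?_
  have := key k
  have h3 : 0 ≤ C / ((T:ℝ) + 1 + k) := by positivity
  simp only [Function.comp]
  rw [add_comm k]
  linarith

lemma q_bound : ∃ C : ℝ, 0 < C ∧ ∀ s t : ℕ, ∃ q : ℝ, q ≤ C / (((s + t : ℕ):ℝ) + 1) ∧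
    HasSum (fun y : Fin 4 → ℤ => Pw (eZ 4) s y * Pw (eZ 4) t y * sq y) q := by
  obtain ⟨C, hC, h⟩ := Z_decay4 (d := 4) le_rfl
  refine ⟨C, hC, ?_⟩
  have key : ∀ s t : ℕ, s ≤ t → ∃ q : ℝ, q ≤ C / (((s + t : ℕ):ℝ) + 1) ∧
      HasSum (fun y : Fin 4 → ℤ => Pw (eZ 4) s y * Pw (eZ 4) t y * sq y) q := by
    intro s t hst
    have h1 := (hasSum_Pw (eZ 4) s sq).mul_left (C / ((t:ℝ) + 1) ^ 2)
    rw [Mop_pow_sq (by norm_num)] at h1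
    have hle : ∀ y : Fin 4 → ℤ, Pw (eZ 4) s y * Pw (eZ 4) t y * sq y
        ≤ C / ((t:ℝ) + 1) ^ 2 * (Pw (eZ 4) s y * sq y) := by
      intro y
      have := mul_le_mul_of_nonneg_right (h t y) (mul_nonneg (Pw_nonneg (eZ 4) s y) (sq_nonneg' y))
      linarith
    have hs : Summable (fun y : Fin 4 → ℤ => Pw (eZ 4) s y * Pw (eZ 4) t y * sq y) :=
      Summable.of_nonneg_of_le (fun y => mul_nonneg (mul_nonneg (Pw_nonneg _ _ _) (Pw_nonneg _ _ _))
        (sq_nonneg' y)) hle h1.summable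
    refine ⟨_, ?_, hs.hasSum⟩
    refine (hasSum_le hle hs.hasSum h1).trans ?_
    have hst' : (s:ℝ) ≤ t := by exact_mod_cast hst
    have hs0 : (0:ℝ) ≤ s := by positivity
    rw [div_mul_eq_mul_div, div_le_div_iff₀ (by positivity) (by positivity)]
    push_cast
    have : (s:ℝ) / 2 * (s + t + 1) ≤ ((t:ℝ) + 1) ^ 2 := by nlinarith
    nlinarith
  intro s t
  rcases le_total s t with hst | hst
  · exact key s t hst
  · obtain ⟨q, h1, h2⟩ := key t s hst
    refine ⟨q, by rwa [Nat.add_comm s t], ?_⟩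
    convert h2 using 2 with y
    ring

/-- lattice ball -/
def lball (m : ℕ) : Finset (Fin 4 → ℤ) :=
  (Fintype.piFinset fun _ : Fin 4 => Finset.Icc (-(m:ℤ)) m).filter
    fun y => (∑ i, (y i) ^ 2) ≤ (m : ℤ) ^ 2

lemma mem_lball (m : ℕ) (y : Fin 4 → ℤ) : y ∈ lball m ↔ (∑ i, (y i) ^ 2) ≤ (m : ℤ) ^ 2 := by
  rw [lball, Finset.mem_filter, and_iff_right_iff_imp]
  intro h
  rw [Fintype.mem_piFinset]
  intro i
  have h1 : (y i) ^ 2 ≤ (m:ℤ) ^ 2 :=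
    (Finset.single_le_sum (f := fun i => (y i) ^ 2) (fun j _ => by positivity) (Finset.mem_univ i)).trans h
  rw [Finset.mem_Icc]
  exact abs_le.mp (abs_le_of_sq_le_sq h1 (by positivity))

lemma card_lball (m : ℕ) : ((lball m).card : ℝ) ≤ (2 * (m:ℝ) + 1) ^ 4 := by
  have h : (lball m).card ≤ (2 * m + 1) ^ 4 := by
    refine (Finset.card_filter_le _ _).trans ?_
    rw [Fintype.card_piFinset]
    simp only [Int.card_Icc, Finset.prod_const, Finset.card_univ, Fintype.card_fin]
    refine Nat.pow_le_pow_left ?_ 4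
    omega
  exact_mod_cast h

lemma lat_eq (m : ℕ) : (∑' y : Fin 4 → ℤ,
    if (∑ i, (y i) ^ 2) ≤ (m : ℤ) ^ 2 then (greenZ 4 y) ^ 2 else 0) = ∑ y ∈ lball m, greenZ 4 y ^ 2 := by
  rw [tsum_eq_sum (s := lball m)]
  · refine Finset.sum_congr rfl fun y hy => ?_
    rw [if_pos ((mem_lball m y).mp hy)]
  · intro y hy
    rw [if_neg (fun h => hy ((mem_lball m y).mpr h))]

lemma lat_low : ∃ D : ℝ, ∀ m : ℕ, 1 ≤ m →
    tri a4 (m ^ 2 + 1) - D ≤ ∑ y ∈ lball m, greenZ 4 y ^ 2 := by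
  obtain ⟨C, hC, h⟩ := q_bound
  choose q hq1 hq2 using h
  refine ⟨3 * C, fun m hm => ?_⟩
  have hm1 : (1:ℝ) ≤ m := by exact_mod_cast hm
  have h1 : tri a4 (m ^ 2 + 1) ≤ SP (eZ 4) (m ^ 2) := le_dbl a4 a4_nonneg (m ^ 2)
  have h2 : HasSum (fun y : Fin 4 → ℤ => gP (eZ 4) (m ^ 2) y ^ 2 * sq y)
      (∑ s ∈ Finset.range (m ^ 2 + 1), ∑ t ∈ Finset.range (m ^ 2 + 1), q s t) := by
    have := hasSum_sum (s := Finset.range (m ^ 2 + 1)) (fun s _ =>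
      hasSum_sum (s := Finset.range (m ^ 2 + 1)) (fun t _ => hq2 s t))
    convert this using 2 with y
    rw [pow_two, gP, Finset.sum_mul_sum, Finset.sum_mul]
    refine Finset.sum_congr rfl fun s _ => ?_
    rw [Finset.sum_mul]
  have h3 : ∑ s ∈ Finset.range (m ^ 2 + 1), ∑ t ∈ Finset.range (m ^ 2 + 1), q s t
      ≤ C * (2 * (m:ℝ) ^ 2 + 1) := by
    calc _ ≤ dbl (fun k => C / ((k:ℝ) + 1)) (m ^ 2) :=
          Finset.sum_le_sum fun s _ => Finset.sum_le_sum fun t _ => hq1 s t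
      _ ≤ tri (fun k => C / ((k:ℝ) + 1)) (2 * m ^ 2 + 1) := dbl_le _ (fun k => by positivity) _
      _ = ∑ k ∈ Finset.range (2 * m ^ 2 + 1), C := by
          refine Finset.sum_congr rfl fun k _ => ?_
          have : (k:ℝ) + 1 ≠ 0 := by positivity
          field_simp
      _ = _ := by
          rw [Finset.sum_const, Finset.card_range, nsmul_eq_mul]
          push_cast
          ring
  have hb : HasSum (fun y => if y ∈ lball m then greenZ 4 y ^ 2 else 0) (∑ y ∈ lball m, greenZ 4 y ^ 2) := by
    have := hasSum_sum_of_ne_finset_zero (L := SummationFilter.unconditional _) (f := fun y => if y ∈ lball m then greenZ 4 y ^ 2 else 0)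
      (s := lball m) (fun y hy => if_neg hy)
    rwa [Finset.sum_congr rfl (fun y hy => if_pos hy)] at this
  have h4 := hasSum_le (fun y => ?_) (gP_sq (eZ 4) (m ^ 2)) (hb.add (h2.mul_left (1 / (m:ℝ) ^ 2)))
  · have h5 : 1 / (m:ℝ) ^ 2 * (∑ s ∈ Finset.range (m ^ 2 + 1), ∑ t ∈ Finset.range (m ^ 2 + 1), q s t) ≤ 3 * C := by
      rw [div_mul_eq_mul_div, one_mul, div_le_iff₀ (by positivity)]
      refine h3.trans ?_
      have hm2 : (1:ℝ) ≤ (m:ℝ) ^ 2 := one_le_pow₀ hm1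
      nlinarith
    linarith
  · have hg := gP_nonneg (eZ 4) (m ^ 2) y
    have hn : 0 ≤ 1 / (m:ℝ) ^ 2 * (gP (eZ 4) (m ^ 2) y ^ 2 * sq y) :=
      mul_nonneg (by positivity) (mul_nonneg (by positivity) (sq_nonneg' y))
    by_cases hy : y ∈ lball m
    · rw [if_pos hy]
      have := pow_le_pow_left₀ hg (gP_le_greenZ (d := 4) le_rfl (m ^ 2) y) 2
      linarith
    · rw [if_neg hy, zero_add]
      have h6 : (m:ℝ) ^ 2 ≤ sq y := by
        rw [mem_lball, not_le] at hy
        have : ((m:ℤ):ℝ) ^ 2 < ((∑ i, (y i) ^ 2 : ℤ) : ℝ) := by exact_mod_cast hy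
        rw [sq]
        push_cast at this
        exact this.le
      rw [div_mul_eq_mul_div, one_mul, le_div_iff₀ (by positivity)]
      exact mul_le_mul_of_nonneg_left h6 (by positivity)

lemma lat_up : ∃ D : ℝ, ∀ m : ℕ, 
    ∑ y ∈ lball m, greenZ 4 y ^ 2 ≤ tri a4 (2 * m ^ 2 + 1) + D := by
  obtain ⟨C, hC, h⟩ := green_tail
  refine ⟨2 * C + 81 * C ^ 2, fun m => ?_⟩
  have h1 : SP (eZ 4) (m ^ 2) ≤ tri a4 (2 * m ^ 2 + 1) := dbl_le a4 a4_nonneg (m ^ 2)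
  have h2 : ∑ y ∈ lball m, gP (eZ 4) (m ^ 2) y ^ 2 ≤ SP (eZ 4) (m ^ 2) :=
    sum_le_hasSum _ (fun y _ => by positivity) (gP_sq (eZ 4) (m ^ 2))
  have h3 : ∑ y ∈ lball m, gP (eZ 4) (m ^ 2) y ≤ ((m ^ 2 : ℕ):ℝ) + 1 :=
    sum_le_hasSum _ (fun y _ => gP_nonneg _ _ _) (gP_sum (by norm_num) (eZ 4) (m ^ 2))
  push_cast at h3
  have hM : (0:ℝ) < (m:ℝ) ^ 2 + 1 := by positivity
  set ρ : ℝ := C / ((m:ℝ) ^ 2 + 1) with hρ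
  have hρ0 : 0 ≤ ρ := by positivity
  have hρM : ρ * ((m:ℝ) ^ 2 + 1) = C := by rw [hρ]; field_simp
  have h4 : ∑ y ∈ lball m, greenZ 4 y ^ 2 ≤ ∑ y ∈ lball m, (gP (eZ 4) (m ^ 2) y ^ 2
      + 2 * ρ * gP (eZ 4) (m ^ 2) y + ρ ^ 2) := by
    refine Finset.sum_le_sum fun y _ => ?_
    have := h (m ^ 2) y
    push_cast at this
    have h5 := pow_le_pow_left₀ (greenZ_nonneg (d := 4) le_rfl y) this 2
    rw [← hρ] at h5
    linarith
  rw [Finset.sum_add_distrib, Finset.sum_add_distrib, ← Finset.mul_sum, Finset.sum_const,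
    nsmul_eq_mul] at h4
  have h6 : 2 * ρ * ∑ y ∈ lball m, gP (eZ 4) (m ^ 2) y ≤ 2 * C := by
    have := mul_le_mul_of_nonneg_left h3 hρ0
    linarith
  have h7 : ((lball m).card : ℝ) * ρ ^ 2 ≤ 81 * C ^ 2 := by
    have hc : (2 * (m:ℝ) + 1) ^ 4 ≤ (9 * ((m:ℝ) ^ 2 + 1)) ^ 2 := by
      have : (2 * (m:ℝ) + 1) ^ 2 ≤ 9 * ((m:ℝ) ^ 2 + 1) := by nlinarith [sq_nonneg ((m:ℝ) - 1)]
      calc (2 * (m:ℝ) + 1) ^ 4 = ((2 * (m:ℝ) + 1) ^ 2) ^ 2 := by ring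
        _ ≤ _ := pow_le_pow_left₀ (by positivity) this 2
    calc _ ≤ (9 * ((m:ℝ) ^ 2 + 1)) ^ 2 * ρ ^ 2 :=
          mul_le_mul_of_nonneg_right ((card_lball m).trans hc) (by positivity)
      _ = 81 * (ρ * ((m:ℝ) ^ 2 + 1)) ^ 2 := by ring
      _ = _ := by rw [hρM]
  linarith

lemma lattice4 (C₀ : ℝ) (hlc : Tendsto (fun t : ℕ => ((t:ℝ) + 1) ^ 2 * a4 t) atTop (nhds C₀)) :
    Tendsto (fun m : ℕ => (∑ y ∈ lball m, greenZ 4 y ^ 2) / (greenZ 4 0 ^ 2 * Real.log m)) atTop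
      (nhds (2 * C₀ / greenZ 4 0 ^ 2)) := by
  obtain ⟨D, hD⟩ := lat_low
  obtain ⟨E, hE⟩ := lat_up
  have hl : Tendsto (fun n : ℕ => Real.log n) atTop atTop :=
    Real.tendsto_log_atTop.comp tendsto_natCast_atTop_atTop
  have t1 := tri_ratio a4 C₀ hlc (fun m => m ^ 2 + 1) (fun m => m) 1 2 one_pos tendsto_id
    (Eventually.of_forall fun m => by push_cast; linarith)
    (by
      filter_upwards [eventually_ge_atTop 1] with m hm
      have hm1 : (1:ℝ) ≤ m := by exact_mod_cast hm
      push_cast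
      nlinarith)
  have t2 := tri_ratio a4 C₀ hlc (fun m => 2 * m ^ 2 + 1) (fun m => m) 1 3 one_pos tendsto_id
    (Eventually.of_forall fun m => by push_cast; nlinarith [sq_nonneg (m:ℝ)])
    (by
      filter_upwards [eventually_ge_atTop 1] with m hm
      have hm1 : (1:ℝ) ≤ m := by exact_mod_cast hm
      push_cast
      nlinarith)
  have u1 := t1.sub (hl.const_div_atTop D)
  have u2 := t2.add (hl.const_div_atTop E)
  rw [sub_zero] at u1
  rw [add_zero] at u2
  have main : Tendsto (fun m : ℕ => (∑ y ∈ lball m, greenZ 4 y ^ 2) / Real.log m) atTop (nhds (2 * C₀)) := by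
    refine tendsto_of_tendsto_of_tendsto_of_le_of_le' u1 u2 ?_ ?_
    · filter_upwards [eventually_ge_atTop 1, hl.eventually_gt_atTop 0] with m hm hlm
      rw [← sub_div]
      exact div_le_div_of_nonneg_right (hD m hm) hlm.le
    · filter_upwards [hl.eventually_gt_atTop 0] with m hlm
      rw [← add_div]
      exact div_le_div_of_nonneg_right (hE m) hlm.le
  refine (main.div_const (greenZ 4 0 ^ 2)).congr fun m => ?_
  rw [div_div, mul_comm (Real.log (m:ℝ))]

end lattice


/-- Proposition 4, `d ≥ 4`. For `d ≥ 4` and each `c > 1`,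
`(1/h_d(n)) ∑_{x,y} (f_{n,c}(x,y) - f̄_{n,c})² → α_d`, where `α_d` is given by
the Green's function formula for `d ≥ 5`, and `α₄` is the stated Green's
function limit (which exists and is positive and finite). -/
theorem Fquad_limit_high_dim (d : ℕ) (hd : 4 ≤ d) :
    ∃ α : ℝ, 0 < α ∧
      (if d = 4 then
          Tendsto (fun m : ℕ =>
              (∑' y : Fin 4 → ℤ,
                  if (∑ i, (y i) ^ 2) ≤ (m : ℤ) ^ 2 then (greenZ 4 y) ^ 2 else 0)
                / ((greenZ 4 0) ^ 2 * Real.log m))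
            atTop (nhds α)
        else α = alphaHigh d) ∧
      ∀ c : ℝ, 1 < c →
        Tendsto (fun n => Fquad (torus d (n + 1)) c / hfun d (n + 1))
          atTop (nhds α) := by
  by_cases h4 : d = 4
  · subst h4
    obtain ⟨C, hC, hlc⟩ := lclt4
    have hg := one_le_greenZ (d := 4) le_rfl
    refine ⟨2 * C / greenZ 4 0 ^ 2, by positivity, ?_, fun c hc => main4 C hlc c hc⟩
    rw [if_pos rfl]
    refine (lattice4 C hlc).congr fun m => ?_
    rw [← lat_eq]
  · have h5 : 5 ≤ d := by omega
    refine ⟨alphaHigh d, alphaHigh_pos h5, ?_, fun c hc => main5 h5 c hc⟩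
    rw [if_neg h4]

end RWPaint
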